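/- arXiv:2103.09119 — 9 statements merged into one kernel-verified Lean document; each statement's English description precedes it below -/
import Mathlib

section
/- Let q be an odd prime power, F a finite field with q elements, a ∈ F with a ≠ 0, and n an even nonnegative integer. Set d = gcd(n, q−1), δ = gcd(n, q+1), and let r be the 2-adic valuation of q²−1 (i.e. 2^r exactly divides q²−1). Let χ(a) = a^((q−1)/2) ∈ F denote the quadratic character of a. Then the residue sum S_q(D_n(x,a)) equals T₁ + T₂ + T₃, where T₁ = 0 if 2^(r−1) divides n and T₁ = −χ(a)^(n/d + n/δ)·a^(n/2) otherwise; T₂ = χ(a)^(n/d)·a^(n/2) if (q−1) divides n and T₂ = 0 otherwise; and T₃ = χ(a)^(n/δ)·a^(n/2) if (q+1) divides n and T₃ = 0 otherwise. -/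
open Polynomial

theorem eval_add_dickson_one {R : Type*} [CommRing R] {a x y : R} (h : x * y = a) (n : ℕ) :
    (dickson 1 a n).eval (x + y) = x ^ n + y ^ n := by
  induction n using Nat.twoStepInduction with
  | zero => simp [dickson_zero]; norm_num
  | one => simp [dickson_one]
  | more n ih₀ ih₁ =>
    rw [dickson_add_two, eval_sub, eval_mul, eval_mul, eval_X, eval_C, ih₀, ih₁, ← h]
    ring

theorem exists_pow_eq_and_pow_eq_iff {K : Type*} [Field K] [IsAlgClosed K] {N n : ℕ}
    (hN : 0 < N) {c z : K} (hc : c ≠ 0) :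
    (∃ y, y ^ N = c ∧ y ^ n = z) ↔ z ^ (N / n.gcd N) = c ^ (n / n.gcd N) := by
  have hd : 0 < n.gcd N := Nat.gcd_pos_of_pos_right _ hN
  obtain ⟨n', hn'⟩ := Nat.gcd_dvd_left n N
  obtain ⟨N', hN'⟩ := Nat.gcd_dvd_right n N
  have bez := Nat.gcd_eq_gcd_ab n N
  set d := n.gcd N
  set s := n.gcdA N
  set t := n.gcdB N
  have h₁ : n / d = n' := by rw [hn', Nat.mul_div_cancel_left _ hd]
  have h₂ : N / d = N' := by rw [hN', Nat.mul_div_cancel_left _ hd]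
  have hcross : n * N' = N * n' := by rw [hn', hN']; ring
  rw [h₁, h₂]
  constructor
  · rintro ⟨y, rfl, rfl⟩
    rw [← pow_mul, ← pow_mul, hcross]
  · intro hz
    obtain ⟨y₀, hy₀⟩ := IsAlgClosed.exists_pow_nat_eq c hN
    have hy₀' : y₀ ≠ 0 := by rintro rfl; simp [hN.ne'] at hy₀; exact hc hy₀.symm
    have hN'0 : N' ≠ 0 := by rintro rfl; simp at hN'; omega
    have hz0 : z ≠ 0 := by
      rintro rfl
      rw [zero_pow hN'0] at hz
      exact pow_ne_zero n' hc hz.symm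
    obtain ⟨u, hu⟩ := IsAlgClosed.exists_pow_nat_eq (z / y₀ ^ n) hd
    have hu0 : u ≠ 0 := by
      rintro rfl
      rw [zero_pow hd.ne'] at hu
      exact div_ne_zero hz0 (pow_ne_zero _ hy₀') hu.symm
    have huN : u ^ N = 1 := by
      rw [hN', pow_mul, hu, div_pow, hz, ← pow_mul, hcross, pow_mul, hy₀,
        div_self (pow_ne_zero _ hc)]
    have hun : (u ^ s) ^ n = z / y₀ ^ n := by
      rw [← hu, ← zpow_natCast u d, bez, zpow_add₀ hu0, zpow_mul u (N : ℤ), zpow_natCast u N, huN,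
        one_zpow, mul_one, mul_comm, zpow_mul, zpow_natCast]
    refine ⟨y₀ * u ^ s, ?_, ?_⟩
    · rw [mul_pow, hy₀, ← zpow_natCast (u ^ s), zpow_comm, zpow_natCast, huN, one_zpow, mul_one]
    · rw [mul_pow, hun, mul_div_cancel₀ _ (pow_ne_zero _ hy₀')]

theorem sum_toFinset_nthRoots {K : Type*} [Field K] [IsAlgClosed K] [DecidableEq K] {m : ℕ}
    (hm : (m : K) ≠ 0) (c : K) :
    ∑ z ∈ (nthRoots m c).toFinset, z = if m = 1 then c else 0 := by
  have hm0 : 0 < m := Nat.pos_of_ne_zero (by rintro rfl; simp at hm)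
  split_ifs with h
  · subst h
    rw [Finset.sum_eq_single c] <;> simp +contextual [mem_nthRoots]
  · have : NeZero (m : K) := ⟨hm⟩
    obtain ⟨ζ, hζ⟩ := HasEnoughRootsOfUnity.exists_primitiveRoot K m
    have hζ1 : ζ ≠ 1 := hζ.ne_one (by omega)
    have hζ0 : ζ ≠ 0 := hζ.ne_zero hm0.ne'
    have key : ζ * ∑ z ∈ (nthRoots m c).toFinset, z = ∑ z ∈ (nthRoots m c).toFinset, z := by
      rw [Finset.mul_sum]
      refine Finset.sum_bij (fun z _ => ζ * z) ?_ ?_ ?_ ?_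
      · simp +contextual [mem_nthRoots hm0, mul_pow, hζ.pow_eq_one]
      · intro x _ y _ hxy
        exact mul_left_cancel₀ hζ0 hxy
      · intro y hy
        refine ⟨ζ⁻¹ * y, ?_, by field_simp⟩
        simpa [mem_nthRoots hm0, mul_pow, hζ.pow_eq_one] using hy
      · simp
    have : (ζ - 1) * ∑ z ∈ (nthRoots m c).toFinset, z = 0 := by linear_combination key
    exact (mul_eq_zero.1 this).resolve_left (sub_ne_zero.2 hζ1)

theorem add_div_eq_add_div_iff {K : Type*} [Field K] {b w z : K} (hw : w ≠ 0) (hz : z ≠ 0) :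
    w + b / w = z + b / z ↔ w = z ∨ w * z = b := by
  have : w + b / w - (z + b / z) = (w - z) * (w * z - b) / (w * z) := by
    field_simp
    ring
  rw [← sub_eq_zero, this, div_eq_zero_iff, mul_eq_zero, sub_eq_zero, sub_eq_zero]
  simp [hw, hz]

theorem sum_image_add_div {K : Type*} [Field K] [DecidableEq K] {s : Finset K} {b : K}
    (h₀ : ∀ z ∈ s, z ≠ 0) (hb : ∀ z ∈ s, b / z ∈ s) :
    ∑ w ∈ s.image (fun z => z + b / z), w = ∑ z ∈ s, z + ∑ z ∈ s with z ^ 2 = b, z := by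
  rw [Finset.sum_filter, ← Finset.sum_add_distrib]
  refine Finset.sum_image' _ fun z hz => ?_
  have hz0 := h₀ z hz
  have hfib : {w ∈ s | w + b / w = z + b / z} = ({z, b / z} : Finset K) := by
    ext w
    simp only [Finset.mem_filter, Finset.mem_insert, Finset.mem_singleton]
    constructor
    · rintro ⟨hw, h⟩
      rwa [add_div_eq_add_div_iff (h₀ w hw) hz0, ← eq_div_iff hz0] at h
    · intro h
      have hw : w ∈ s := by rcases h with rfl | rfl; exacts [hz, hb z hz]
      refine ⟨hw, ?_⟩
      rwa [add_div_eq_add_div_iff (h₀ w hw) hz0, ← eq_div_iff hz0]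
  rw [hfib]
  by_cases h : z ^ 2 = b
  · have : b / z = z := by rw [← h]; field_simp
    simp [this, h]
  · have hne : z ≠ b / z := by rw [Ne, eq_div_iff hz0, ← sq]; exact h
    have hbz : b / z ≠ 0 := h₀ _ (hb z hz)
    have hb0 : b ≠ 0 := by rintro rfl; simp at hbz
    have h' : (b / z) ^ 2 ≠ b := by
      intro h'
      apply h
      field_simp at h'
      exact h'.symm
    rw [Finset.sum_pair hne]
    simp [h, h']

theorem mem_range_algebraMap_of_pow_card_eq {F K : Type*} [Field F] [Fintype F] [Field K]
    [Algebra F K] {w : K} (hw : w ^ Fintype.card F = w) : ∃ x : F, algebraMap F K x = w := by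
  classical
  have hq : 1 < Fintype.card F := Fintype.one_lt_card
  have hne : (X ^ Fintype.card F - X : K[X]) ≠ 0 := FiniteField.X_pow_card_sub_X_ne_zero K hq
  have hsub : Finset.univ.image (algebraMap F K) ⊆
      (X ^ Fintype.card F - X : K[X]).roots.toFinset := by
    intro y hy
    obtain ⟨x, -, rfl⟩ := Finset.mem_image.1 hy
    simp [hne, ← map_pow, FiniteField.pow_card]
  have heq := Finset.eq_of_subset_of_card_le hsub <| by
    rw [Finset.card_image_of_injective _ (algebraMap F K).injective, Finset.card_univ]
    refine (Multiset.toFinset_card_le _).trans ((card_roots' _).trans ?_)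
    rw [FiniteField.X_pow_card_sub_X_natDegree_eq K hq]
  have : w ∈ Finset.univ.image (algebraMap F K) := by
    rw [heq]
    simp [hne, hw]
  simpa using this

theorem exists_eq_add_div_iff {F K : Type*} [Field F] [Fintype F] [Field K] [IsAlgClosed K]
    [Algebra F K] {a : F} (ha : a ≠ 0) (y : K) (hy : y ≠ 0) :
    (∃ x : F, algebraMap F K x = y + algebraMap F K a / y) ↔
      y ^ (Fintype.card F - 1) = 1 ∨ y ^ (Fintype.card F + 1) = algebraMap F K a := by
  have hq : 1 < Fintype.card F := Fintype.one_lt_card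
  have haK : algebraMap F K a ≠ 0 := by simpa using ha
  have hfrob : (y + algebraMap F K a / y) ^ Fintype.card F =
      y ^ Fintype.card F + algebraMap F K a / y ^ Fintype.card F := by
    have := map_add (FiniteField.frobeniusAlgHom F K) y (algebraMap F K a / y)
    simpa [div_pow, ← map_pow, FiniteField.pow_card] using this
  have hfix : (∃ x : F, algebraMap F K x = y + algebraMap F K a / y) ↔
      (y + algebraMap F K a / y) ^ Fintype.card F = y + algebraMap F K a / y := by
    constructor
    · rintro ⟨x, hx⟩
      rw [← hx, ← map_pow, FiniteField.pow_card]
    · exact mem_range_algebraMap_of_pow_card_eq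
  rw [hfix, hfrob, add_div_eq_add_div_iff (pow_ne_zero _ hy) hy, ← pow_succ]
  refine or_congr_left ?_
  conv_lhs => rw [← Nat.sub_add_cancel hq.le, pow_succ]
  simp [hy]

theorem map_image_eval_dickson {F K : Type*} [Field F] [Fintype F] [DecidableEq F] [Field K]
    [IsAlgClosed K] [DecidableEq K] [Algebra F K] {a : F} (ha : a ≠ 0) (n : ℕ) {d δ : ℕ}
    (hd : d = n.gcd (Fintype.card F - 1)) (hδ : δ = n.gcd (Fintype.card F + 1)) :
    (Finset.univ.image fun x : F => (dickson 1 a n).eval x).image (algebraMap F K) =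
      ((nthRoots ((Fintype.card F - 1) / d) (1 : K)).toFinset ∪
        (nthRoots ((Fintype.card F + 1) / δ) (algebraMap F K a ^ (n / δ))).toFinset).image
          (fun z => z + algebraMap F K a ^ n / z) := by
  have hq : 1 < Fintype.card F := Fintype.one_lt_card
  set q := Fintype.card F
  have haK : algebraMap F K a ≠ 0 := by simpa using ha
  have hdq : 0 < (q - 1) / d := by
    rw [hd]
    exact Nat.div_pos (Nat.gcd_le_right _ (by omega)) (Nat.gcd_pos_of_pos_right _ (by omega))
  have hδq : 0 < (q + 1) / δ := by
    rw [hδ]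
    exact Nat.div_pos (Nat.gcd_le_right _ (by omega)) (Nat.gcd_pos_of_pos_right _ (by omega))
  have hmem (z : K) : z ∈ (nthRoots ((q - 1) / d) (1 : K)).toFinset ∪
      (nthRoots ((q + 1) / δ) (algebraMap F K a ^ (n / δ))).toFinset ↔
      ∃ y, (y ^ (q - 1) = 1 ∨ y ^ (q + 1) = algebraMap F K a) ∧ y ^ n = z := by
    rw [Finset.mem_union, Multiset.mem_toFinset, Multiset.mem_toFinset, mem_nthRoots hdq,
      mem_nthRoots hδq]
    have h₁ := exists_pow_eq_and_pow_eq_iff (n := n) (N := q - 1) (z := z) (by omega) one_ne_zero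
    have h₂ := exists_pow_eq_and_pow_eq_iff (n := n) (N := q + 1) (z := z) (by omega) haK
    rw [one_pow] at h₁
    rw [hd, hδ, ← h₁, ← h₂, ← exists_or]
    simp only [or_and_right]
  have hy0 {y : K} (hy : y ^ (q - 1) = 1 ∨ y ^ (q + 1) = algebraMap F K a) : y ≠ 0 := by
    rintro rfl
    rcases hy with hy | hy
    · rw [zero_pow (by omega)] at hy
      exact zero_ne_one hy
    · rw [zero_pow (by omega)] at hy
      exact haK hy.symm
  have heval {x : F} {y : K} (hy : y ≠ 0)
      (hx : algebraMap F K x = y + algebraMap F K a / y) :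
      algebraMap F K ((dickson 1 a n).eval x) = y ^ n + algebraMap F K a ^ n / y ^ n := by
    rw [← eval_map_apply, map_dickson, hx, eval_add_dickson_one (by field_simp),
      div_pow]
  ext w
  simp only [Finset.mem_image, Finset.mem_univ, true_and, exists_exists_eq_and]
  constructor
  · rintro ⟨x, rfl⟩
    obtain ⟨y, hy⟩ : ∃ y : K, y ^ 2 - algebraMap F K x * y + algebraMap F K a = 0 := by
      have hdeg : (X ^ 2 - C (algebraMap F K x) * X + C (algebraMap F K a)).degree = 2 := by
        compute_degree!
      obtain ⟨y, hy⟩ := IsAlgClosed.exists_root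
        (X ^ 2 - C (algebraMap F K x) * X + C (algebraMap F K a)) (by rw [hdeg]; norm_num)
      exact ⟨y, by simpa [IsRoot.def] using hy⟩
    have hyne : y ≠ 0 := by
      rintro rfl
      simp [ha] at hy
    have hx : algebraMap F K x = y + algebraMap F K a / y := by
      field_simp
      linear_combination -hy
    exact ⟨y ^ n, (hmem _).2 ⟨y, (exists_eq_add_div_iff ha y hyne).1 ⟨x, hx⟩, rfl⟩,
      (heval hyne hx).symm⟩
  · rintro ⟨z, hz, rfl⟩
    obtain ⟨y, hy, rfl⟩ := (hmem z).1 hz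
    obtain ⟨x, hx⟩ := (exists_eq_add_div_iff ha y (hy0 hy)).2 hy
    exact ⟨x, heval (hy0 hy) hx⟩

theorem odd_div_gcd_of_two_pow_dvd {N n s : ℕ} (hN : ¬ 2 ^ (s + 1) ∣ N) (hn : 2 ^ s ∣ n) :
    Odd (N / n.gcd N) := by
  have hN0 : 0 < N := Nat.pos_of_ne_zero (by rintro rfl; simp at hN)
  have hd : 0 < n.gcd N := Nat.gcd_pos_of_pos_right _ hN0
  have hcop := Nat.coprime_div_gcd_div_gcd hd
  have h₁ := Nat.div_mul_cancel (Nat.gcd_dvd_left n N)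
  have h₂ := Nat.div_mul_cancel (Nat.gcd_dvd_right n N)
  by_contra! h
  rw [Nat.not_odd_iff_even] at h
  have hodd : Nat.Coprime 2 (n / n.gcd N) :=
    (hcop.coprime_dvd_right h.two_dvd).symm
  rw [← h₁] at hn
  have hs := (hodd.pow_left s).dvd_of_dvd_mul_left hn
  apply hN
  rw [← h₂, pow_succ, mul_comm]
  exact mul_dvd_mul h.two_dvd hs

theorem even_div_gcd_of_not_two_pow_dvd {N n s : ℕ} (hN0 : 0 < N) (hN : 2 ^ s ∣ N)
    (hn : ¬ 2 ^ s ∣ n) : Even (N / n.gcd N) ∧ Odd (n / n.gcd N) := by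
  have hd : 0 < n.gcd N := Nat.gcd_pos_of_pos_right _ hN0
  have hcop := Nat.coprime_div_gcd_div_gcd hd
  have h₂ := Nat.div_mul_cancel (Nat.gcd_dvd_right n N)
  have heven : Even (N / n.gcd N) := by
    by_contra! h
    rw [Nat.not_even_iff_odd] at h
    rw [← h₂] at hN
    exact hn (((Nat.coprime_two_left.2 h).pow_left s |>.dvd_of_dvd_mul_left hN).trans
      (Nat.gcd_dvd_left n N))
  exact ⟨heven, Nat.coprime_two_left.1 (hcop.coprime_dvd_right heven.two_dvd).symm⟩

/-- The parities of `(q - 1) / gcd (n, q - 1)` and `(q + 1) / gcd (n, q + 1)` for even `n`. -/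
theorem parity_div_gcd {q n r : ℕ} (hq : Odd q) (hq1 : 1 < q) (hn : Even n)
    (hr : 2 ^ r ∣ q ^ 2 - 1 ∧ ¬ 2 ^ (r + 1) ∣ q ^ 2 - 1) :
    (2 ^ (r - 1) ∣ n → Odd ((q - 1) / n.gcd (q - 1)) ∧ Odd ((q + 1) / n.gcd (q + 1))) ∧
    (¬ 2 ^ (r - 1) ∣ n →
      (Odd ((q - 1) / n.gcd (q - 1)) ∧
        Even ((q + 1) / n.gcd (q + 1)) ∧ Odd (n / n.gcd (q + 1))) ∨
      (Odd ((q + 1) / n.gcd (q + 1)) ∧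
        Even ((q - 1) / n.gcd (q - 1)) ∧ Odd (n / n.gcd (q - 1)))) := by
  have key : ∀ {M N : ℕ}, M * N = q ^ 2 - 1 → 2 ∣ M → ¬ 4 ∣ M → 2 ∣ N → 0 < N →
      (2 ^ (r - 1) ∣ n → Odd (M / n.gcd M) ∧ Odd (N / n.gcd N)) ∧
      (¬ 2 ^ (r - 1) ∣ n → Odd (M / n.gcd M) ∧ Even (N / n.gcd N) ∧ Odd (n / n.gcd N)) := by
    rintro M N hMN ⟨k, rfl⟩ hM4 ⟨l, rfl⟩ hN
    have hk : Nat.Coprime 2 k := Nat.coprime_two_left.2 (by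
      by_contra h
      rw [Nat.not_odd_iff_even] at h
      exact hM4 (by obtain ⟨j, rfl⟩ := h.two_dvd; exact ⟨j, by ring⟩))
    rw [← hMN] at hr
    have hr1 : 1 ≤ r := by
      rcases Nat.eq_zero_or_pos r with rfl | h
      · exact absurd ⟨k * (2 * l), by ring⟩ hr.2
      · exact h
    obtain ⟨t, rfl⟩ := Nat.exists_eq_add_of_le' hr1
    rw [Nat.add_sub_cancel]
    have hM : Odd (2 * k / n.gcd (2 * k)) :=
      odd_div_gcd_of_two_pow_dvd (s := 1) (by simpa using hM4) (by simpa using hn.two_dvd)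
    have hN₁ : 2 ^ t ∣ 2 * l := by
      have h := hr.1
      rw [pow_succ, mul_comm, mul_assoc, Nat.mul_dvd_mul_iff_left two_pos] at h
      exact (hk.pow_left t).dvd_of_dvd_mul_left h
    have hN₂ : ¬ 2 ^ (t + 1) ∣ 2 * l := by
      intro h
      apply hr.2
      rw [pow_succ, mul_comm, mul_assoc]
      exact mul_dvd_mul_left 2 (h.mul_left k)
    exact ⟨fun h => ⟨hM, odd_div_gcd_of_two_pow_dvd hN₂ h⟩,
      fun h => ⟨hM, even_div_gcd_of_not_two_pow_dvd hN hN₁ h⟩⟩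
  have hfac : (q + 1) * (q - 1) = q ^ 2 - 1 := by
    have := Nat.sq_sub_sq q 1
    simpa using this.symm
  obtain ⟨k, rfl⟩ := hq
  by_cases h4 : 4 ∣ 2 * k + 1 - 1
  · have h := key hfac (by omega) (by omega) (by omega) (by omega)
    exact ⟨fun h' => (h.1 h').symm, fun h' => Or.inr (h.2 h')⟩
  · have h := key ((mul_comm _ _).trans hfac) (by omega) h4 (by omega) (by omega)
    exact ⟨h.1, fun h' => Or.inl (h.2 h')⟩

/-- For subsets `s`, `t` whose intersection lies in `{e, -e}`, the union summed with the square
roots of `e ^ 2` counted twice. -/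
theorem sum_union_add_sum_filter {K : Type*} [Field K] [DecidableEq K] {s t : Finset K} {e : K}
    (he : e ≠ -e) (hst : ∀ z ∈ s, z ∈ t → z ^ 2 = e ^ 2) :
    ∑ z ∈ s ∪ t, z + ∑ z ∈ s ∪ t with z ^ 2 = e ^ 2, z =
      ((if e ∈ s ∧ e ∈ t ∨ e ∉ s ∧ e ∉ t then 0 else e) +
        (if -e ∈ s ∧ -e ∈ t ∨ -e ∉ s ∧ -e ∉ t then 0 else -e)) +
        ∑ z ∈ s, z + ∑ z ∈ t, z := by
  have hpair (u : Finset K) : ∑ z ∈ u with z ^ 2 = e ^ 2, z =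
      (if e ∈ u then e else 0) + (if -e ∈ u then -e else 0) := by
    have : {z ∈ u | z ^ 2 = e ^ 2} = {z ∈ ({e, -e} : Finset K) | z ∈ u} := by
      ext z
      simp [sq_eq_sq_iff_eq_or_eq_neg, and_comm]
    rw [this, Finset.sum_filter, Finset.sum_pair he]
  have hinter : {z ∈ s ∩ t | z ^ 2 = e ^ 2} = s ∩ t :=
    Finset.filter_true_of_mem fun z hz =>
      hst z (Finset.mem_inter.1 hz).1 (Finset.mem_inter.1 hz).2
  have h₁ := hpair (s ∪ t)
  have h₂ := hpair (s ∩ t)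
  rw [hinter] at h₂
  have h₃ := Finset.sum_union_inter (s₁ := s) (s₂ := t) (f := fun z : K => z)
  rw [h₁, eq_sub_of_add_eq h₃, h₂]
  simp only [Finset.mem_union, Finset.mem_inter]
  by_cases es : e ∈ s <;> by_cases et : e ∈ t <;> by_cases ns : -e ∈ s <;> by_cases nt : -e ∈ t <;>
    simp [es, et, ns, nt] <;> ring

theorem div_gcd_eq_one_iff {N n : ℕ} (hN : 0 < N) : N / n.gcd N = 1 ↔ N ∣ n := by
  rw [Nat.div_eq_iff_eq_mul_left (Nat.gcd_pos_of_pos_right _ hN) (Nat.gcd_dvd_right n N), one_mul,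
    eq_comm, Nat.gcd_eq_right_iff_dvd]

/-- Theorem 1.2 (main theorem): closed form for the residue sum of Dickson polynomials
over a finite field of odd order `q`. -/
theorem dickson_residue_sum {F : Type*} [Field F] [Fintype F] [DecidableEq F]
    {q : ℕ} (hF : Fintype.card F = q) (hq : Odd q)
    (a : F) (ha : a ≠ 0) (n : ℕ) (hn : Even n)
    (d δ r : ℕ) (hd : d = Nat.gcd n (q - 1)) (hδ : δ = Nat.gcd n (q + 1))
    (hr : 2 ^ r ∣ q ^ 2 - 1 ∧ ¬ 2 ^ (r + 1) ∣ q ^ 2 - 1) :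
    ∑ y ∈ Finset.image (fun x : F => Polynomial.eval x (Polynomial.dickson 1 a n)) Finset.univ, y =
      (if 2 ^ (r - 1) ∣ n then 0
        else -((a ^ ((q - 1) / 2)) ^ (n / d + n / δ) * a ^ (n / 2))) +
      (if (q - 1) ∣ n then (a ^ ((q - 1) / 2)) ^ (n / d) * a ^ (n / 2) else 0) +
      (if (q + 1) ∣ n then (a ^ ((q - 1) / 2)) ^ (n / δ) * a ^ (n / 2) else 0) := by
  classical
  subst hF
  set q := Fintype.card F
  have hq1 : 1 < q := Fintype.one_lt_card
  obtain ⟨K, _, _, _⟩ : ∃ (K : Type _) (_ : Field K) (_ : Algebra F K), IsAlgClosed K :=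
    ⟨AlgebraicClosure F, inferInstance, inferInstance, inferInstance⟩
  set α : K := algebraMap F K a with hα
  have hα0 : α ≠ 0 := by simpa [hα] using ha
  have hqK : (q : K) = 0 := by
    rw [← map_natCast (algebraMap F K), FiniteField.cast_card_eq_zero, map_zero]
  obtain ⟨h, hh⟩ := hn.two_dvd
  obtain ⟨k, hk⟩ := hq
  have hk2 : (q - 1) / 2 = k := by omega
  have hn2 : n / 2 = h := by omega
  have hχ2 : (α ^ k) ^ 2 = 1 := by
    rw [← pow_mul, hα, ← map_pow, show k * 2 = q - 1 by omega,
      FiniteField.pow_card_sub_one_eq_one a ha, map_one]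
  have h2K : (2 : K) ≠ 0 := by
    intro h2
    have : (q : K) = 1 := by rw [hk]; push_cast; rw [h2]; ring
    rw [hqK] at this
    exact zero_ne_one this
  have he0 : α ^ h ≠ 0 := pow_ne_zero _ hα0
  have hene : α ^ h ≠ -α ^ h := by
    intro he
    have : 2 * α ^ h = 0 := by linear_combination he
    exact (mul_ne_zero h2K he0) this
  have hdn : n / d * d = n := Nat.div_mul_cancel (hd ▸ Nat.gcd_dvd_left _ _)
  have hδn : n / δ * δ = n := Nat.div_mul_cancel (hδ ▸ Nat.gcd_dvd_left _ _)
  have hdq : (q - 1) / d * d = q - 1 := Nat.div_mul_cancel (hd ▸ Nat.gcd_dvd_right _ _)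
  have hδq : (q + 1) / δ * δ = q + 1 := Nat.div_mul_cancel (hδ ▸ Nat.gcd_dvd_right _ _)
  have hparity := parity_div_gcd ⟨k, hk⟩ hq1 hn hr
  have hdone : (q - 1) / d = 1 ↔ q - 1 ∣ n := by
    rw [hd]
    exact div_gcd_eq_one_iff (by omega)
  have hδone : (q + 1) / δ = 1 ↔ q + 1 ∣ n := by
    rw [hδ]
    exact div_gcd_eq_one_iff (by omega)
  rw [← hd, ← hδ] at hparity
  set A := (q - 1) / d
  set B := (q + 1) / δ
  set u := n / d
  set v := n / δ
  have hA0 : 0 < A := Nat.pos_of_ne_zero fun h0 => by rw [h0] at hdq; omega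
  have hB0 : 0 < B := Nat.pos_of_ne_zero fun h0 => by rw [h0] at hδq; omega
  have hAK : (A : K) ≠ 0 := by
    intro h0
    have : ((q - 1 : ℕ) : K) = 0 := by rw [← hdq, Nat.cast_mul, h0, zero_mul]
    rw [Nat.cast_sub hq1.le, hqK] at this
    simp at this
  have hBK : (B : K) ≠ 0 := by
    intro h0
    have : ((q + 1 : ℕ) : K) = 0 := by rw [← hδq, Nat.cast_mul, h0, zero_mul]
    rw [Nat.cast_add, hqK] at this
    simp at this
  have hmemA (z : K) : z ∈ (nthRoots A (1 : K)).toFinset ↔ z ^ A = 1 := by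
    rw [Multiset.mem_toFinset, mem_nthRoots hA0]
  have hmemB (z : K) : z ∈ (nthRoots B (α ^ v)).toFinset ↔ z ^ B = α ^ v := by
    rw [Multiset.mem_toFinset, mem_nthRoots hB0]
  have hnA : n * A = u * (q - 1) := by rw [← hdq]; nth_rw 1 [← hdn]; ring
  have hnB : n * B = v * (q + 1) := by rw [← hδq]; nth_rw 1 [← hδn]; ring
  have hαq : α ^ (q - 1) = 1 := by rw [← hχ2, ← pow_mul]; congr 1; omega
  have hαq' : α ^ (q + 1) = α ^ 2 := by
    rw [show q + 1 = q - 1 + 2 by omega, pow_add, hαq, one_mul]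
  have hαA : (α ^ n) ^ A = 1 := by rw [← pow_mul, hnA, mul_comm, pow_mul, hαq, one_pow]
  have hαB : (α ^ n) ^ B = α ^ v * α ^ v := by
    rw [← pow_mul, hnB, mul_comm, pow_mul, hαq']; ring
  have heA : (α ^ h) ^ A = (α ^ k) ^ u := by
    rw [← pow_mul, ← pow_mul]
    congr 1
    have : 2 * (h * A) = 2 * (k * u) := by
      rw [← mul_assoc, ← hh, hnA, show q - 1 = 2 * k by omega]; ring
    omega
  have heB : (α ^ h) ^ B = (α ^ k) ^ v * α ^ v := by
    rw [← pow_mul, ← pow_mul, ← pow_add]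
    congr 1
    have : 2 * (h * B) = 2 * (k * v + v) := by
      rw [← mul_assoc, ← hh, hnB, hk]; ring
    omega
  have hαv : α ^ v ≠ 0 := pow_ne_zero _ hα0
  have hsum : ∑ w ∈ (Finset.univ.image fun x : F => (dickson 1 a n).eval x).image
      (algebraMap F K), w = _ :=
    congrArg (fun s : Finset K => ∑ w ∈ s, w) (map_image_eval_dickson ha n hd hδ)
  have hs0 : ∀ z ∈ (nthRoots A (1 : K)).toFinset ∪ (nthRoots B (α ^ v)).toFinset, z ≠ 0 := by
    intro z hz
    rw [Finset.mem_union, hmemA, hmemB] at hz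
    rintro rfl
    rw [zero_pow hA0.ne', zero_pow hB0.ne'] at hz
    exact hz.elim zero_ne_one hαv.symm
  have hsb : ∀ z ∈ (nthRoots A (1 : K)).toFinset ∪ (nthRoots B (α ^ v)).toFinset,
      α ^ n / z ∈ (nthRoots A (1 : K)).toFinset ∪ (nthRoots B (α ^ v)).toFinset := by
    intro z hz
    rw [Finset.mem_union, hmemA, hmemB] at hz ⊢
    rw [div_pow, div_pow, hαA, hαB]
    refine hz.imp (fun hz => by rw [hz, div_one]) fun hz => by rw [hz, mul_div_cancel_right₀ _ hαv]
  have hinter : ∀ z ∈ (nthRoots A (1 : K)).toFinset, z ∈ (nthRoots B (α ^ v)).toFinset →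
      z ^ 2 = (α ^ h) ^ 2 := by
    intro z hzA hzB
    rw [hmemA] at hzA
    rw [hmemB] at hzB
    have h₁ : z ^ (q - 1) = 1 := by rw [← hdq, pow_mul, hzA, one_pow]
    have h₂ : z ^ (q + 1) = α ^ n := by rw [← hδq, pow_mul, hzB, ← pow_mul, hδn]
    rw [show q + 1 = q - 1 + 2 by omega, pow_add, h₁, one_mul] at h₂
    rw [h₂, hh, ← pow_mul, mul_comm]
  have hnh : α ^ n = (α ^ h) ^ 2 := by rw [hh, ← pow_mul, mul_comm]
  apply (algebraMap F K).injective
  rw [Finset.sum_image (algebraMap F K).injective.injOn, ← map_sum] at hsum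
  rw [hsum, sum_image_add_div hs0 hsb, hnh, sum_union_add_sum_filter hene hinter,
    sum_toFinset_nthRoots hAK, sum_toFinset_nthRoots hBK, map_add, map_add]
  simp only [hk2, hn2, hmemA, hmemB, hdone, hδone]
  congr 1
  congr 1
  · rw [apply_ite (algebraMap F K)]
    simp only [map_zero, map_neg, map_mul, map_pow, ← hα, neg_pow (α ^ h), heA, heB,
      ← mul_assoc, mul_eq_right₀ hαv]
    have hneg : (-1 : K) ≠ 1 := fun h1 => h2K (by linear_combination -h1)
    rw [sq_eq_one_iff] at hχ2
    by_cases hdvd : 2 ^ (r - 1) ∣ n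
    · obtain ⟨hA, hB⟩ := hparity.1 hdvd
      rcases hχ2 with hχ | hχ <;> rcases neg_one_pow_eq_or K u with hu | hu <;>
        rcases neg_one_pow_eq_or K v with hv | hv <;>
        simp [hdvd, hA.neg_one_pow, hB.neg_one_pow, hχ, hu, hv, hneg]
    · rcases hparity.2 hdvd with ⟨hA, hB, hv⟩ | ⟨hB, hA, hu⟩
      · rcases hχ2 with hχ | hχ <;> rcases neg_one_pow_eq_or K u with hu | hu <;>
          simp [hdvd, hA.neg_one_pow, hB.neg_one_pow, hχ, hu, hv.neg_one_pow, hneg, pow_add]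
      · rcases hχ2 with hχ | hχ <;> rcases neg_one_pow_eq_or K v with hv | hv <;>
          simp [hdvd, hA.neg_one_pow, hB.neg_one_pow, hχ, hv, hu.neg_one_pow, hneg, pow_add]
  · rw [apply_ite (algebraMap F K)]
    refine if_ctx_congr Iff.rfl (fun hdvd => ?_) fun _ => (map_zero _).symm
    rw [hdone.2 hdvd, pow_one] at heA hαA
    rw [map_mul, map_pow, map_pow, map_pow, ← hα, ← heA, ← sq, ← hnh, hαA]
  · rw [apply_ite (algebraMap F K)]
    refine if_ctx_congr Iff.rfl (fun hdvd => ?_) fun _ => (map_zero _).symm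
    rw [hδone.2 hdvd, pow_one] at heB
    rw [map_mul, map_pow, map_pow, map_pow, ← hα, heB, ← mul_assoc, ← sq, ← pow_mul, mul_comm v 2,
      pow_mul, hχ2, one_pow, one_mul]
end

section
/- Let q be an odd prime power, F a finite field with q elements, a ∈ F, and n an odd natural number. Then the residue sum S_q(D_n(x,a)) = 0. -/
open Polynomial

theorem eval_neg_dickson {R : Type*} [CommRing R] (k : ℕ) (a x : R) :
    ∀ n : ℕ, (dickson k a n).eval (-x) = (-1) ^ n * (dickson k a n).eval x
  | 0 => by simp [dickson_zero]
  | 1 => by simp [dickson_one]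
  | n + 2 => by
    simp only [dickson_add_two, eval_sub, eval_mul, eval_X, eval_C,
      eval_neg_dickson k a x n, eval_neg_dickson k a x (n + 1)]
    ring

/-- Proposition: for odd `n`, the residue sum of the Dickson polynomial vanishes. -/
theorem dickson_residue_sum_odd {F : Type*} [Field F] [Fintype F] [DecidableEq F]
    {q : ℕ} (hF : Fintype.card F = q) (hq : Odd q)
    (a : F) (n : ℕ) (hn : Odd n) :
    ∑ y ∈ Finset.image (fun x : F => Polynomial.eval x (Polynomial.dickson 1 a n))
        Finset.univ, y = 0 := by
  have hchar : ringChar F ≠ 2 := fun h => by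
    have heven := FiniteField.even_card_iff_char_two.mp h
    rw [hF] at heven
    exact absurd hq (Nat.not_odd_iff.mpr heven)
  set s := Finset.image (fun x : F => eval x (dickson 1 a n)) Finset.univ with hs
  have hneg : ∀ y ∈ s, -y ∈ s := by
    simp only [hs, Finset.mem_image, Finset.mem_univ, true_and]
    rintro _ ⟨x, rfl⟩
    exact ⟨-x, by rw [eval_neg_dickson, hn.neg_one_pow, neg_one_mul]⟩
  have hsum : ∑ y ∈ s, y = ∑ y ∈ s, -y :=
    Finset.sum_nbij' Neg.neg Neg.neg hneg hneg (by simp) (by simp) (by simp)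
  rw [Finset.sum_neg_distrib] at hsum
  exact (Ring.eq_self_iff_eq_zero_of_char_ne_two hchar).mp hsum.symm
end

section
/- Let K be a field, a ∈ K with a ≠ 0, and u, v ∈ K with u ≠ 0 and v ≠ 0. Set x = u + a·u⁻¹ and y = v + a·v⁻¹. Then for every natural number n, D_n(x,a) = D_n(y,a) if and only if uⁿ = vⁿ or uⁿ·vⁿ = aⁿ. -/
open Polynomial

theorem dickson_one_eval_add {R : Type*} [CommRing R] (s t : R) :
    ∀ n : ℕ, (dickson 1 (s * t) n).eval (s + t) = s ^ n + t ^ n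
  | 0 => by
    simp only [dickson_zero, eval_sub, eval_ofNat, Nat.cast_one, eval_one, pow_zero]
    norm_num
  | 1 => by simp
  | n + 2 => by
    simp only [dickson_add_two, eval_sub, eval_mul, eval_X, eval_C,
      dickson_one_eval_add s t n, dickson_one_eval_add s t (n + 1)]
    ring

theorem add_mul_inv_eq_add_mul_inv_iff {K : Type*} [Field K] {p q : K} (b : K)
    (hp : p ≠ 0) (hq : q ≠ 0) : p + b * p⁻¹ = q + b * q⁻¹ ↔ p = q ∨ p * q = b := by
  have key : (p + b * p⁻¹ - (q + b * q⁻¹)) * (p * q) = (p - q) * (p * q - b) := by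
    field_simp
    ring
  rw [← sub_eq_zero, ← mul_eq_zero_iff_right (mul_ne_zero hp hq), key, mul_eq_zero,
    sub_eq_zero, sub_eq_zero]

/-- `D_n(u + a/u, a) = D_n(v + a/v, a)` iff `uⁿ = vⁿ` or `uⁿ vⁿ = aⁿ`. -/
theorem dickson_eval_eq_iff {K : Type*} [Field K]
    (a u v : K) (ha : a ≠ 0) (hu : u ≠ 0) (hv : v ≠ 0)
    (x y : K) (hx : x = u + a * u⁻¹) (hy : y = v + a * v⁻¹) (n : ℕ) :
    Polynomial.eval x (Polynomial.dickson 1 a n) =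
        Polynomial.eval y (Polynomial.dickson 1 a n) ↔
      u ^ n = v ^ n ∨ u ^ n * v ^ n = a ^ n := by
  have eval_dickson {w : K} (hw : w ≠ 0) :
      (dickson 1 a n).eval (w + a * w⁻¹) = w ^ n + a ^ n * (w ^ n)⁻¹ := by
    have h := dickson_one_eval_add w (a * w⁻¹) n
    rwa [mul_left_comm, mul_inv_cancel₀ hw, mul_one, mul_pow, inv_pow] at h
  rw [hx, hy, eval_dickson hu, eval_dickson hv]
  exact add_mul_inv_eq_add_mul_inv_iff _ (pow_ne_zero n hu) (pow_ne_zero n hv)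
end

section
/- Let q be an odd prime power with q > 3, F a finite field with q elements, a ∈ F with a ≠ 0, and n an even natural number. Suppose x, y ∈ F are such that x² − 4a is a nonzero square in F while y² − 4a is a nonsquare in F, and D_n(x,a) = D_n(y,a). Then D_n(x,a) = 2·a^(n/2) or D_n(x,a) = −2·a^(n/2). -/
open Polynomial

/-- The Pell-type identity `D_n(x,a)² - 4aⁿ = (x² - 4a) e²`, together with the companion identity
for consecutive indices. -/
theorem exists_dickson_one_eval_pell {R : Type*} [CommRing R] (a x : R) (n : ℕ) :
    ∃ e e' : R,
      (dickson 1 a n).eval x ^ 2 - 4 * a ^ n = (x ^ 2 - 4 * a) * e ^ 2 ∧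
      (dickson 1 a (n + 1)).eval x ^ 2 - 4 * a ^ (n + 1) = (x ^ 2 - 4 * a) * e' ^ 2 ∧
      (dickson 1 a n).eval x * (dickson 1 a (n + 1)).eval x - 2 * a ^ n * x =
        (x ^ 2 - 4 * a) * (e * e') := by
  induction n with
  | zero =>
    refine ⟨0, 1, ?_, ?_, ?_⟩ <;> simp <;> ring
  | succ n ih =>
    obtain ⟨e, e', h, h', hm⟩ := ih
    refine ⟨e', x * e' - a * e, h', ?_, ?_⟩
    · simp only [dickson_add_two, eval_sub, eval_mul, eval_X, eval_C]
      linear_combination x ^ 2 * h' + a ^ 2 * h - 2 * x * a * hm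
    · simp only [dickson_add_two, eval_sub, eval_mul, eval_X, eval_C]
      linear_combination x * h' - a * hm

/-- Any common value of `D_n(·,a)` on a hyperbolic and an elliptic element is `±2a^(n/2)`. -/
theorem hyperbolic_elliptic_overlap {F : Type*} [Field F] [Fintype F]
    {q : ℕ} (hF : Fintype.card F = q) (hq : Odd q) (hq3 : 3 < q)
    (a : F) (ha : a ≠ 0) (n : ℕ) (hn : Even n) (x y : F)
    (hx : x ^ 2 - 4 * a ≠ 0 ∧ IsSquare (x ^ 2 - 4 * a))
    (hy : ¬ IsSquare (y ^ 2 - 4 * a))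
    (heq : Polynomial.eval x (Polynomial.dickson 1 a n) =
      Polynomial.eval y (Polynomial.dickson 1 a n)) :
    Polynomial.eval x (Polynomial.dickson 1 a n) = 2 * a ^ (n / 2) ∨
      Polynomial.eval x (Polynomial.dickson 1 a n) = -(2 * a ^ (n / 2)) := by
  obtain ⟨e, -, he, -⟩ := exists_dickson_one_eval_pell a x n
  obtain ⟨f, -, hf, -⟩ := exists_dickson_one_eval_pell a y n
  obtain ⟨s, hs⟩ := hx.2
  have hf0 : f = 0 := by
    by_contra h
    refine hy ⟨s * e / f, ?_⟩
    rw [heq, hf, hs] at he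
    field_simp
    linear_combination he
  rw [← heq, hf0] at hf
  rw [← sq_eq_sq_iff_eq_or_eq_neg, mul_pow, ← pow_mul, Nat.div_mul_cancel hn.two_dvd]
  linear_combination hf
end

section
/- Let q be an odd prime power and n an even positive integer. Set d = gcd(n, q−1), δ = gcd(n, q+1), and let r be the 2-adic valuation of q²−1. Then: (1) it is not the case that both (q−1)/d and (q+1)/δ are even; (2) if both (q−1)/d and (q+1)/δ are odd, then it is not the case that both n/d and n/δ are odd; (3) if 2^(r−1) divides n but 2^r does not divide n, then n/d and n/δ have opposite parity (one is odd and the other is even). -/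
theorem odd_iff_factorization_two_eq_zero {m : ℕ} (hm : m ≠ 0) :
    Odd m ↔ m.factorization 2 = 0 := by
  rw [Nat.factorization_eq_zero_iff, ← Nat.not_even_iff_odd, even_iff_two_dvd]
  simp [Nat.prime_two, hm]

theorem odd_div_gcd_iff {m k : ℕ} (hm : m ≠ 0) (hk : k ≠ 0) :
    Odd (m / Nat.gcd m k) ↔ m.factorization 2 ≤ k.factorization 2 := by
  have hdiv : m / Nat.gcd m k ≠ 0 :=
    (Nat.div_pos (Nat.gcd_le_left k (Nat.pos_of_ne_zero hm))
      (Nat.gcd_pos_of_pos_left k (Nat.pos_of_ne_zero hm))).ne'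
  rw [odd_iff_factorization_two_eq_zero hdiv, Nat.factorization_div (Nat.gcd_dvd_left m k),
    Nat.factorization_gcd hm hk]
  simp only [Finsupp.coe_tsub, Pi.sub_apply, Finsupp.inf_apply]
  omega

/-- Of two consecutive even numbers, exactly one is divisible by four. -/
theorem factorization_two_pred_succ {q : ℕ} (hodd : Odd q) (hq : 1 < q) :
    ((q - 1).factorization 2 = 1 ∧ 2 ≤ (q + 1).factorization 2) ∨
      (2 ≤ (q - 1).factorization 2 ∧ (q + 1).factorization 2 = 1) := by
  have h {m k : ℕ} (hm : m ≠ 0) : 2 ^ k ∣ m ↔ k ≤ m.factorization 2 :=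
    Nat.prime_two.pow_dvd_iff_le_factorization hm
  have hp : q - 1 ≠ 0 := by omega
  have hs : q + 1 ≠ 0 := by omega
  have p₁ := h (k := 1) hp
  have p₂ := h (k := 2) hp
  have s₁ := h (k := 1) hs
  have s₂ := h (k := 2) hs
  obtain ⟨t, rfl⟩ := hodd
  omega

/-- Parity constraints on `(q-1)/d`, `(q+1)/δ`, `n/d`, `n/δ` for even `n`. -/
theorem parity_constraints (q n : ℕ) (hq : IsPrimePow q) (hodd : Odd q)
    (hn : Even n) (hpos : 0 < n)
    (d δ r : ℕ) (hd : d = Nat.gcd n (q - 1)) (hδ : δ = Nat.gcd n (q + 1))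
    (hr : 2 ^ r ∣ q ^ 2 - 1 ∧ ¬ 2 ^ (r + 1) ∣ q ^ 2 - 1) :
    (¬ (Even ((q - 1) / d) ∧ Even ((q + 1) / δ))) ∧
    ((Odd ((q - 1) / d) ∧ Odd ((q + 1) / δ)) → ¬ (Odd (n / d) ∧ Odd (n / δ))) ∧
    ((2 ^ (r - 1) ∣ n ∧ ¬ 2 ^ r ∣ n) →
      ((Odd (n / d) ∧ Even (n / δ)) ∨ (Even (n / d) ∧ Odd (n / δ)))) := by
  subst hd hδ
  have hq1 : 1 < q := hq.one_lt
  have hp : q - 1 ≠ 0 := by omega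
  have hs : q + 1 ≠ 0 := by omega
  have hn0 : n ≠ 0 := hpos.ne'
  have hprod : q ^ 2 - 1 = (q + 1) * (q - 1) := by
    simpa using Nat.sq_sub_sq q 1
  have hn1 : 1 ≤ n.factorization 2 := by
    rw [← Nat.prime_two.pow_dvd_iff_le_factorization hn0, pow_one]
    exact hn.two_dvd
  rw [hprod, Nat.prime_two.pow_dvd_iff_le_factorization (mul_ne_zero hs hp),
    Nat.prime_two.pow_dvd_iff_le_factorization (mul_ne_zero hs hp),
    Nat.factorization_mul hs hp, Finsupp.add_apply] at hr
  have hcases := factorization_two_pred_succ hodd hq1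
  rw [Nat.prime_two.pow_dvd_iff_le_factorization hn0,
    Nat.prime_two.pow_dvd_iff_le_factorization hn0]
  simp only [← Nat.not_odd_iff_even, Nat.gcd_comm n, odd_div_gcd_iff hp hn0,
    odd_div_gcd_iff hs hn0]
  simp only [Nat.gcd_comm _ n, odd_div_gcd_iff hn0 hp, odd_div_gcd_iff hn0 hs]
  omega
end

section
/- Let q be an odd prime power with q > 3, F a finite field with q elements, a ∈ F with a ≠ 0, and n an even natural number. Set d = gcd(n, q−1). Then the number of distinct values taken by D_n(·,a) on the hyperbolic set H_q(a) = {x ∈ F : x² − 4a is a nonzero square} equals ⌊(q−1)/(2d)⌋ + c, where c = 1 if either (a is a nonsquare in F and (q−1)/d is odd) or (a is a square in F and d ≠ 2), and c = 0 otherwise. -/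
open Polynomial
open scoped Classical

theorem dickson_one_mul_eval_add {R : Type*} [CommRing R] (x y : R) :
    ∀ n, (dickson 1 (x * y) n).eval (x + y) = x ^ n + y ^ n
  | 0 => by simp only [pow_zero, dickson_zero]; norm_num
  | 1 => by simp only [eval_X, dickson_one, pow_one]
  | n + 2 => by
    simp only [eval_sub, eval_mul, dickson_one_mul_eval_add x y _, eval_X, dickson_add_two, eval_C]
    ring

/-- If the fibres of `f` on `T` are the orbits of a map `σ` preserving `T`, then the image of `T`
has `(|T| + |Fix σ|) / 2` elements. -/
theorem two_mul_card_image_eq_card_add_card_fixed {α β : Type*} [DecidableEq α] [DecidableEq β]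
    (T : Finset α) (f : α → β) (σ : α → α) (hσ : ∀ u ∈ T, σ u ∈ T)
    (hf : ∀ u ∈ T, ∀ v ∈ T, f u = f v ↔ u = v ∨ u = σ v) :
    2 * (T.image f).card = T.card + (T.filter fun u => σ u = u).card := by
  have hT := Finset.card_eq_sum_card_image f T
  have hfix := Finset.card_eq_sum_card_fiberwise (f := f) (s := T.filter fun u => σ u = u)
    (t := T.image f) (fun u hu => by
      simpa using ⟨u, (Finset.mem_filter.1 hu).1, rfl⟩)
  rw [hT, hfix, ← Finset.sum_add_distrib, mul_comm, ← smul_eq_mul, ← Finset.sum_const]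
  refine Finset.sum_congr rfl fun b hb => ?_
  obtain ⟨v, hv, rfl⟩ := Finset.mem_image.1 hb
  have h1 : T.filter (fun u => f u = f v) = {v, σ v} := by
    ext u
    simp only [Finset.mem_filter, Finset.mem_insert, Finset.mem_singleton]
    refine ⟨fun h => (hf u h.1 v hv).1 h.2, fun h => ?_⟩
    have hu : u ∈ T := by rcases h with rfl | rfl <;> [exact hv; exact hσ _ hv]
    exact ⟨hu, (hf u hu v hv).2 h⟩
  have hσσ : σ (σ v) = v ∨ σ (σ v) = σ v := by
    have h2 := (hf v hv (σ v) (hσ v hv)).1 ((hf _ (hσ v hv) v hv).2 (Or.inr rfl)).symm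
    rcases h2 with h2 | h2
    · right; rw [← h2, ← h2]
    · exact Or.inl h2.symm
  rw [Finset.filter_comm, h1]
  by_cases h : σ v = v
  · simp [h, Finset.filter_singleton]
  · have h3 : σ (σ v) ≠ σ v := by
      intro h3
      have h4 := (hf v hv (σ v) (hσ v hv)).1 ((hf _ (hσ v hv) v hv).2 (Or.inr rfl)).symm
      rw [h3] at h4
      rcases h4 with h4 | h4 <;> exact h h4.symm
    rw [Finset.card_pair (Ne.symm h), Finset.filter_insert, if_neg h, Finset.filter_singleton,
      if_neg h3, Finset.card_empty]

section Field

variable {F : Type*} [Field F]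

theorem units_add_mul_inv_eq_iff (A u v : Fˣ) :
    (u : F) + ((A * u⁻¹ : Fˣ) : F) = v + ((A * v⁻¹ : Fˣ) : F) ↔ u = v ∨ u = A * v⁻¹ := by
  have hu := u.ne_zero
  have hv := v.ne_zero
  rw [Units.ext_iff, Units.ext_iff]
  simp only [Units.val_mul, Units.val_inv_eq_inv_val]
  rw [← sub_eq_zero, ← sub_eq_zero (a := (u : F)) (b := v),
    ← sub_eq_zero (a := (u : F)) (b := (A : F) * (v : F)⁻¹), ← mul_eq_zero,
    ← mul_eq_zero_iff_left hu (b := (u : F) + _ - _)]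
  field_simp
  constructor
  · intro h; linear_combination h
  · intro h; linear_combination h

theorem sq_sub_four_mul_isSquare_iff (h2 : (2 : F) ≠ 0) (α : Fˣ) (x : F) :
    (x ^ 2 - 4 * (α : F) ≠ 0 ∧ IsSquare (x ^ 2 - 4 * (α : F))) ↔
      ∃ y : Fˣ, y ^ 2 ≠ α ∧ (y : F) + ((α * y⁻¹ : Fˣ) : F) = x := by
  constructor
  · rintro ⟨h0, s, hs⟩
    have hs0 : s ≠ 0 := by rintro rfl; simp [hs] at h0
    have hyz : (x + s) / 2 * ((x - s) / 2) = α := by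
      field_simp
      linear_combination hs
    have hy : (x + s) / 2 ≠ 0 := fun h => α.ne_zero (by rw [← hyz, h, zero_mul])
    refine ⟨Units.mk0 _ hy, fun h => ?_, ?_⟩
    · have h' := congrArg Units.val h
      rw [Units.val_pow_eq_pow_val, Units.val_mk0, ← hyz] at h'
      have : (x + s) / 2 * s = 0 := by
        field_simp at h' ⊢
        have h4 : (2 : F) * ((x + s) * s) = 0 := by linear_combination h'
        simpa [h2, or_comm] using h4
      exact mul_ne_zero hy hs0 this
    · rw [Units.val_mul, Units.val_inv_eq_inv_val, Units.val_mk0, ← hyz,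
        mul_comm ((x + s) / 2) ((x - s) / 2), mul_inv_cancel_right₀ hy]
      field_simp
      ring
  · rintro ⟨y, hy, rfl⟩
    have hy0 := y.ne_zero
    have key : ((y : F) + ((α * y⁻¹ : Fˣ) : F)) ^ 2 - 4 * α =
        ((y : F) - ((α * y⁻¹ : Fˣ) : F)) * ((y : F) - ((α * y⁻¹ : Fˣ) : F)) := by
      simp only [Units.val_mul, Units.val_inv_eq_inv_val]
      field_simp
      ring
    rw [key]
    refine ⟨fun h => hy ?_, _, rfl⟩
    have h' := sub_eq_zero.1 (mul_self_eq_zero.1 h)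
    rw [← Units.ext_iff, eq_mul_inv_iff_mul_eq] at h'
    rw [sq, h']

theorem image_dickson_eq_image_pow [Fintype F] (h2 : (2 : F) ≠ 0) (α : Fˣ) (n : ℕ) :
    (fun x : F => eval x (dickson 1 (α : F) n)) ''
        {x : F | x ^ 2 - 4 * (α : F) ≠ 0 ∧ IsSquare (x ^ 2 - 4 * (α : F))} =
      (((Finset.univ.filter fun y : Fˣ => y ^ 2 ≠ α).image (· ^ n)).image
        fun u : Fˣ => (u : F) + ((α ^ n * u⁻¹ : Fˣ) : F) : Finset F) := by
  have hD (y : Fˣ) : eval ((y : F) + ((α * y⁻¹ : Fˣ) : F)) (dickson 1 (α : F) n) =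
      ((y ^ n : Fˣ) : F) + ((α ^ n * (y ^ n)⁻¹ : Fˣ) : F) := by
    have := dickson_one_mul_eval_add (y : F) ((α * y⁻¹ : Fˣ) : F) n
    rw [← Units.val_mul, mul_comm y, inv_mul_cancel_right] at this
    rw [this, ← inv_pow, ← mul_pow]
    simp
  ext w
  simp only [sq_sub_four_mul_isSquare_iff h2]
  simp only [Set.mem_image, Set.mem_ofPred_eq, Finset.coe_image, Finset.coe_filter,
    Finset.mem_univ, true_and]
  constructor
  · rintro ⟨_, ⟨y, hy, rfl⟩, rfl⟩
    exact ⟨_, ⟨y, hy, rfl⟩, (hD y).symm⟩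
  · rintro ⟨_, ⟨y, hy, rfl⟩, rfl⟩
    exact ⟨_, ⟨y, hy, rfl⟩, hD y⟩

theorem card_image_pow_units [Fintype F] (n : ℕ) :
    ((Finset.univ : Finset Fˣ).image (· ^ n)).card =
      (Fintype.card F - 1) / n.gcd (Fintype.card F - 1) := by
  have h := IsCyclic.card_powMonoidHom_range (G := Fˣ) n
  rw [Nat.card_eq_fintype_card (α := Fˣ), Fintype.card_units, Nat.gcd_comm] at h
  rw [← h, ← SetLike.coe_sort_coe, Nat.card_coe_set_eq, ← Set.ncard_coe_finset]
  congr 1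
  ext
  simp

theorem exists_pow_eq_one_sq_ne_one [Fintype F] {n : ℕ} (h0 : 0 < Fintype.card F - 1)
    (h : ¬ n.gcd (Fintype.card F - 1) ∣ 2) : ∃ z : Fˣ, z ^ n = 1 ∧ z ^ 2 ≠ 1 := by
  obtain ⟨g, hg⟩ := IsCyclic.exists_ofOrder_eq_natCard (α := Fˣ)
  rw [Nat.card_eq_fintype_card, Fintype.card_units] at hg
  obtain ⟨m, hm⟩ := Nat.gcd_dvd_right n (Fintype.card F - 1)
  have hm0 : m ≠ 0 := by rintro rfl; omega
  have hz : orderOf (g ^ m) = n.gcd (Fintype.card F - 1) := by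
    rw [orderOf_pow_of_dvd hm0 (hg ▸ hm ▸ dvd_mul_left _ _), hg]
    exact Nat.div_eq_of_eq_mul_left (Nat.pos_of_ne_zero hm0) hm
  refine ⟨g ^ m, orderOf_dvd_iff_pow_eq_one.1 (hz ▸ Nat.gcd_dvd_left _ _), fun h' => h ?_⟩
  exact hz ▸ orderOf_dvd_of_pow_eq_one h'

theorem isSquare_of_pow_two_mul_eq_pow [Fintype F] (hF : ringChar F ≠ 2) {α y : Fˣ} {n : ℕ}
    (hdvd : n.gcd (Fintype.card F - 1) ∣ Fintype.card F / 2) (h : (y ^ n) ^ 2 = α ^ n) :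
    IsSquare α := by
  have h1 : (α * (y ^ 2)⁻¹) ^ n = 1 := by
    rw [mul_pow, inv_pow, ← pow_mul, mul_comm 2, pow_mul, h, mul_inv_cancel]
  have h2 : (α * (y ^ 2)⁻¹) ^ (Fintype.card F - 1) = 1 := by
    rw [← Fintype.card_units, pow_card_eq_one]
  have h3 := (FiniteField.unit_isSquare_iff hF _).2
    (orderOf_dvd_iff_pow_eq_one.1 ((orderOf_dvd_of_pow_eq_one
      (pow_gcd_eq_one.2 ⟨h1, h2⟩)).trans hdvd))
  simpa using h3.mul (IsSquare.sq y)

end Field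

/-- The number of distinct values of `D_n(·,a)` on the hyperbolic set. -/
theorem hyperbolic_image_card {F : Type*} [Field F] [Fintype F]
    {q : ℕ} (hF : Fintype.card F = q) (hq : Odd q) (hq3 : 3 < q)
    (a : F) (ha : a ≠ 0) (n : ℕ) (hn : Even n)
    (d : ℕ) (hd : d = Nat.gcd n (q - 1)) :
    Set.ncard ((fun x : F => Polynomial.eval x (Polynomial.dickson 1 a n)) ''
        {x : F | x ^ 2 - 4 * a ≠ 0 ∧ IsSquare (x ^ 2 - 4 * a)}) =
      (q - 1) / (2 * d) +
        (if (¬ IsSquare a ∧ Odd ((q - 1) / d)) ∨ (IsSquare a ∧ d ≠ 2) then 1 else 0) := by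
  have hchar : ringChar F ≠ 2 := fun h => by
    have := FiniteField.even_card_of_char_two h
    rw [hF] at this
    exact Nat.not_even_iff_odd.2 hq (Nat.even_iff.2 this)
  have h2 : (2 : F) ≠ 0 := Ring.two_ne_zero hchar
  obtain ⟨α, rfl⟩ : ∃ α : Fˣ, (α : F) = a := ⟨Units.mk0 a ha, rfl⟩
  have hsq : IsSquare (α : F) ↔ IsSquare α := by
    rw [FiniteField.unit_isSquare_iff hchar, FiniteField.isSquare_iff hchar ha, Units.ext_iff]
    simp
  obtain ⟨k, hk⟩ := hn
  have hpow : α ^ n = (α ^ k) ^ 2 := by rw [← pow_mul, hk, mul_two]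
  rw [image_dickson_eq_image_pow h2, Set.ncard_coe_finset]
  simp only [hsq]
  set G := (Finset.univ : Finset Fˣ).image (· ^ n) with hG
  set T := (Finset.univ.filter fun y : Fˣ => y ^ 2 ≠ α).image (· ^ n) with hT
  have hGcard : G.card = (q - 1) / d := by rw [hG, card_image_pow_units, hF, hd]
  have hcount := two_mul_card_image_eq_card_add_card_fixed T
    (fun u : Fˣ => (u : F) + ((α ^ n * u⁻¹ : Fˣ) : F)) (fun u => α ^ n * u⁻¹) (by
      intro u hu
      obtain ⟨y, hy, rfl⟩ := Finset.mem_image.1 hu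
      refine Finset.mem_image.2 ⟨α * y⁻¹, ?_, by simp [mul_pow]⟩
      simp only [Finset.mem_filter, Finset.mem_univ, true_and] at hy ⊢
      intro h
      apply hy
      rw [mul_pow, inv_pow, sq α, mul_assoc, mul_eq_left, mul_inv_eq_one] at h
      exact h.symm) (fun u _ v _ => units_add_mul_inv_eq_iff _ u v)
  have hfix : ∀ u : Fˣ, α ^ n * u⁻¹ = u ↔ u ^ 2 = α ^ n := fun u => by
    rw [mul_inv_eq_iff_eq_mul, sq, eq_comm]
  simp only [hfix] at hcount
  have hsub : (T.filter fun u => u ^ 2 = α ^ n) ⊆ {α ^ k, -α ^ k} := by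
    intro u hu
    have := (Finset.mem_filter.1 hu).2
    rw [hpow, Units.ext_iff, Units.val_pow_eq_pow_val, Units.val_pow_eq_pow_val,
      sq_eq_sq_iff_eq_or_eq_neg, ← Units.val_neg, ← Units.ext_iff, ← Units.ext_iff] at this
    simpa using this
  have hle : (T.filter fun u => u ^ 2 = α ^ n).card ≤ 2 :=
    (Finset.card_le_card hsub).trans Finset.card_le_two
  have hd_dvd : d ∣ q - 1 := hd ▸ Nat.gcd_dvd_right _ _
  have hq1 : 2 ∣ q - 1 := by obtain ⟨r, hr⟩ := hq; omega
  have hd2 : 2 ∣ d := hd ▸ Nat.dvd_gcd ⟨k, by omega⟩ hq1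
  have hd0 : 0 < d := Nat.pos_of_dvd_of_pos hd_dvd (by omega)
  rw [mul_comm 2 d, ← Nat.div_div_eq_div_mul, ← hGcard]
  by_cases hα : IsSquare α
  · obtain ⟨b, hb⟩ := hα
    have hbk : b ^ n = α ^ k := by rw [hb, ← sq, ← pow_mul, hk, two_mul]
    by_cases hdd : d = 2
    · have hTG : T = G.erase (α ^ k) := by
        ext u
        simp only [hT, hG, Finset.mem_image, Finset.mem_filter, Finset.mem_univ, true_and,
          Finset.mem_erase]
        constructor
        · rintro ⟨y, hy, rfl⟩
          refine ⟨fun h => hy ?_, y, rfl⟩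
          have h1 : (y * b⁻¹) ^ n = 1 := by
            rw [mul_pow, inv_pow, h, ← hbk, mul_inv_cancel]
          have h2 : (y * b⁻¹) ^ (q - 1) = 1 := by
            rw [← hF, ← Fintype.card_units, pow_card_eq_one]
          have h3 := pow_gcd_eq_one.2 ⟨h1, h2⟩
          rwa [← hd, hdd, mul_pow, inv_pow, mul_inv_eq_one, sq b, ← hb] at h3
        · rintro ⟨hu, y, rfl⟩
          refine ⟨y, fun h => hu ?_, rfl⟩
          rw [← h, ← pow_mul, hk, two_mul]
      have hmem : α ^ k ∈ G := Finset.mem_image.2 ⟨b, Finset.mem_univ _, hbk⟩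
      have hTcard := Finset.card_erase_add_one hmem
      rw [← hTG] at hTcard
      have hle1 : (T.filter fun u => u ^ 2 = α ^ n).card ≤ 1 := by
        refine (Finset.card_le_card (t := {-α ^ k}) fun u hu => ?_).trans_eq
          (Finset.card_singleton _)
        have h1 := hsub hu
        have h2 := (Finset.mem_filter.1 hu).1
        rw [hTG] at h2
        simpa [(Finset.mem_erase.1 h2).1] using h1
      rw [if_neg (by rintro (h | h); exacts [h.1 ⟨b, hb⟩, h.2 hdd])]
      omega
    · obtain ⟨z, hz, hz2⟩ : ∃ z : Fˣ, z ^ n = 1 ∧ z ^ 2 ≠ 1 := by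
        refine exists_pow_eq_one_sq_ne_one (by omega) ?_
        rw [hF, ← hd]
        exact fun h => hdd (Nat.dvd_antisymm h hd2)
      have hTG : T = G := by
        refine Finset.Subset.antisymm (Finset.image_subset_image (Finset.filter_subset _ _)) ?_
        intro u hu
        obtain ⟨y, -, rfl⟩ := Finset.mem_image.1 hu
        by_cases hy : y ^ 2 = α
        · refine Finset.mem_image.2 ⟨y * z, ?_, by simp [mul_pow, hz]⟩
          simpa [mul_pow, hy] using hz2
        · exact Finset.mem_image.2 ⟨y, by simpa using hy, rfl⟩
      have hpos : 0 < (T.filter fun u => u ^ 2 = α ^ n).card := by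
        refine Finset.card_pos.2 ⟨α ^ k, Finset.mem_filter.2 ⟨?_, hpow.symm⟩⟩
        rw [hTG]
        exact Finset.mem_image.2 ⟨b, Finset.mem_univ _, hbk⟩
      rw [if_pos (Or.inr ⟨⟨b, hb⟩, hdd⟩)]
      rw [hTG] at hcount hle hpos ⊢
      omega
  · have hTG : T = G := by
      rw [hT, Finset.filter_true_of_mem]
      exact fun y _ h => hα ⟨y, by rw [← h, sq]⟩
    by_cases hodd : Odd G.card
    · rw [if_pos (Or.inl ⟨hα, hodd⟩)]
      obtain ⟨r, hr⟩ := hodd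
      rw [hTG] at hcount hle ⊢
      omega
    · have hempty : (T.filter fun u => u ^ 2 = α ^ n).card = 0 := by
        rw [Finset.card_eq_zero, Finset.filter_eq_empty_iff]
        intro u hu h
        obtain ⟨y, -, rfl⟩ := Finset.mem_image.1 hu
        refine hα (isSquare_of_pow_two_mul_eq_pow hchar ?_ h)
        rw [hF, ← hd]
        obtain ⟨r, hr⟩ := Nat.not_odd_iff_even.1 hodd
        refine ⟨r, ?_⟩
        have h5 : q - 1 = d * (r + r) := by rw [← hr, hGcard, Nat.mul_div_cancel' hd_dvd]
        rw [mul_add] at h5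
        obtain ⟨s, hs⟩ := hq
        omega
      rw [if_neg (by rintro (h | h); exacts [hodd h.2, hα h.1])]
      have := Nat.not_odd_iff.1 hodd
      rw [hTG] at hcount hempty ⊢
      omega
end

section
/- Let q be an odd prime power with q > 3, F a finite field with q elements, a ∈ F with a ≠ 0, and n an even natural number. Set d = gcd(n, q−1) and let χ(a) = a^((q−1)/2). Then the sum in F of the distinct values taken by D_n(·,a) on the hyperbolic set H_q(a) = {x ∈ F : x² − 4a is a nonzero square} equals: 2·χ(a)^(n/d)·a^(n/2) if d = q−1; otherwise, if a is a nonsquare: 0 when (q−1)/d is even, and (−1)^(n/d)·a^(n/2) when (q−1)/d is odd; and if a is a square: −a^(n/2) when (q−1)/d is odd and d = 2; a^(n/2) when (q−1)/d is odd and d ≠ 2; −2·a^(n/2) when (q−1)/d is even and d = 2; and 0 when (q−1)/d is even and d ≠ 2. -/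
open Polynomial
open scoped Classical

theorem Polynomial.eval_dickson_one_add {R : Type*} [CommRing R] {a x y : R} (h : x * y = a) :
    ∀ n : ℕ, (dickson 1 a n).eval (x + y) = x ^ n + y ^ n
  | 0 => by simp [dickson_zero]; norm_num
  | 1 => by simp
  | n + 2 => by
    rw [dickson_add_two]
    simp only [eval_sub, eval_mul, eval_X, eval_C, eval_dickson_one_add h n,
      eval_dickson_one_add h (n + 1)]
    rw [← h]
    ring

/-- The sum of the distinct values of `w + A / w` on a finite set stable under `w ↦ A / w`. -/
theorem sum_image_add_div_s12 {F : Type*} [Field F] {A : F} (hA : A ≠ 0) (S : Finset F)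
    (h0 : ∀ w ∈ S, w ≠ 0) (hS : ∀ w ∈ S, A / w ∈ S) :
    ∑ y ∈ S.image (fun w => w + A / w), y = ∑ w ∈ S, w + ∑ w ∈ S with w ^ 2 = A, w := by
  rw [Finset.sum_filter, ← Finset.sum_add_distrib]
  refine Finset.sum_image' _ fun i hi => ?_
  have hi0 := h0 i hi
  have hfib : S.filter (fun j => j + A / j = i + A / i) = {i, A / i} := by
    ext j
    simp only [Finset.mem_filter, Finset.mem_insert, Finset.mem_singleton]
    constructor
    · rintro ⟨hj, e⟩
      have hj0 := h0 j hj
      have : (j - i) * (j * i - A) = 0 := by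
        field_simp at e
        linear_combination e
      rcases mul_eq_zero.1 this with h | h
      · exact Or.inl (sub_eq_zero.1 h)
      · right
        rw [eq_div_iff hi0]
        exact sub_eq_zero.1 h
    · rintro (rfl | rfl)
      · exact ⟨hi, rfl⟩
      · refine ⟨hS i hi, ?_⟩
        field_simp
        ring
  rw [hfib]
  by_cases h : i ^ 2 = A
  · have e : A / i = i := by rw [div_eq_iff hi0, ← h, sq]
    simp [e, h]
  · have hne : i ≠ A / i := fun e => h (by rw [eq_div_iff hi0] at e; rw [sq, e])
    have h' : (A / i) ^ 2 ≠ A := by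
      intro e
      apply h
      field_simp at e
      exact e.symm
    rw [Finset.sum_pair hne, if_neg h, if_neg h', add_zero, add_zero]

namespace FiniteField

variable {F : Type*} [Field F] [Fintype F]

theorem exists_ne_zero_pow_eq_iff {n m d : ℕ} (hd : d = Nat.gcd n (Fintype.card F - 1))
    (hm : d * m = Fintype.card F - 1) (w : F) :
    (∃ u : F, u ≠ 0 ∧ u ^ n = w) ↔ w ^ m = 1 := by
  have hpos : 0 < Fintype.card F - 1 := Nat.sub_pos_of_lt Fintype.one_lt_card
  constructor
  · rintro ⟨u, hu, rfl⟩
    obtain ⟨k, hk⟩ : d ∣ n := hd ▸ Nat.gcd_dvd_left _ _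
    rw [← pow_mul, show n * m = (Fintype.card F - 1) * k by rw [hk, ← hm]; ring, pow_mul,
      pow_card_sub_one_eq_one u hu, one_pow]
  · intro hw
    have hm0 : m ≠ 0 := by rintro rfl; omega
    have hw0 : w ≠ 0 := by rintro rfl; simp [hm0] at hw
    obtain ⟨g, hg⟩ := IsCyclic.exists_generator (α := Fˣ)
    have hord : orderOf g = Fintype.card F - 1 := by
      rw [orderOf_eq_card_of_forall_mem_zpowers hg, Nat.card_eq_fintype_card,
        Fintype.card_units]
    obtain ⟨j, hj⟩ := Subgroup.mem_zpowers_iff.1 (hg (Units.mk0 w hw0))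
    have h1 : g ^ (j * m) = 1 := by
      rw [zpow_mul, hj]
      ext
      simpa using hw
    rw [← orderOf_dvd_iff_zpow_eq_one, hord, ← hm] at h1
    push_cast at h1
    obtain ⟨t, rfl⟩ := Int.dvd_of_mul_dvd_mul_right (by exact_mod_cast hm0) h1
    refine ⟨((g ^ (Nat.gcdA n (Fintype.card F - 1) * t) : Fˣ) : F), Units.ne_zero _, ?_⟩
    have key : (g ^ (Nat.gcdA n (Fintype.card F - 1) * t)) ^ n = Units.mk0 w hw0 := by
      have hone : g ^ ((Fintype.card F - 1 : ℕ) : ℤ) = 1 := by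
        rw [zpow_natCast, ← hord, pow_orderOf_eq_one]
      rw [← hj, hd, Nat.gcd_eq_gcd_ab, add_mul, zpow_add, mul_assoc _ _ t, mul_assoc _ _ t,
        zpow_mul g _ (_ * t), zpow_mul g _ (_ * t), hone, one_zpow, mul_one, ← zpow_natCast,
        ← zpow_mul, ← zpow_mul, mul_comm (n : ℤ)]
    rw [← Units.val_pow_eq_pow_val, key, Units.val_mk0]

theorem exists_orderOf_eq {k : ℕ} (hk : k ∣ Fintype.card F - 1) :
    ∃ ζ : F, ζ ≠ 0 ∧ orderOf ζ = k := by
  have hpos : 0 < Fintype.card F - 1 := Nat.sub_pos_of_lt Fintype.one_lt_card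
  obtain ⟨g, hg⟩ := IsCyclic.exists_ofOrder_eq_natCard (α := Fˣ)
  rw [Nat.card_eq_fintype_card, Fintype.card_units] at hg
  obtain ⟨l, hl⟩ := hk
  have hl0 : l ≠ 0 := by rintro rfl; omega
  refine ⟨((g ^ l : Fˣ) : F), Units.ne_zero _, ?_⟩
  rw [orderOf_units, orderOf_pow_of_dvd hl0 (by rw [hg, hl]; exact dvd_mul_left _ _), hg, hl,
    Nat.mul_div_cancel _ (Nat.pos_of_ne_zero hl0)]

theorem sum_pow_eq_one_eq_zero {m : ℕ} (hm : m ∣ Fintype.card F - 1) (hm1 : m ≠ 1) :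
    ∑ w : F with w ^ m = 1, w = 0 := by
  obtain ⟨ζ, hζ0, hζ⟩ := exists_orderOf_eq hm
  have hζm : ζ ^ m = 1 := hζ ▸ pow_orderOf_eq_one ζ
  have hζ1 : ζ ≠ 1 := by rintro rfl; exact hm1 (by simpa using hζ.symm)
  have key : ζ * ∑ w : F with w ^ m = 1, w = ∑ w : F with w ^ m = 1, w := by
    rw [Finset.mul_sum]
    refine Finset.sum_nbij' (ζ * ·) (ζ⁻¹ * ·) ?_ ?_ ?_ ?_ ?_ <;>
      simp +contextual [mul_pow, hζm, hζ0]
  exact (mul_left_eq_self₀.1 key).resolve_left hζ1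

/-- The `n`-th powers of the elements of `Fˣ` that are not square roots of `a`. -/
theorem exists_sq_ne_pow_eq_iff {a : F} (ha : a ≠ 0) {n m d : ℕ} (hn : Even n) (hd2 : 2 ≤ d)
    (hd : d = Nat.gcd n (Fintype.card F - 1)) (hm : d * m = Fintype.card F - 1) (w : F) :
    (∃ u : F, u ≠ 0 ∧ u ^ 2 ≠ a ∧ u ^ n = w) ↔
      w ^ m = 1 ∧ ¬ ((d = 2 ∧ IsSquare a) ∧ w = a ^ (n / 2)) := by
  have half (s : F) : (s ^ 2) ^ (n / 2) = s ^ n := by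
    rw [← pow_mul, Nat.mul_div_cancel' hn.two_dvd]
  rw [← exists_ne_zero_pow_eq_iff hd hm]
  constructor
  · rintro ⟨u, hu, hua, rfl⟩
    refine ⟨⟨u, hu, rfl⟩, ?_⟩
    rintro ⟨⟨h2, s, hs⟩, e⟩
    rw [← sq] at hs
    have hs0 : s ≠ 0 := by rintro rfl; simp [hs] at ha
    rw [hs, half] at e
    have h1 : (u / s) ^ n = 1 := by rw [div_pow, e, div_self (pow_ne_zero _ hs0)]
    have h2' : (u / s) ^ 2 = 1 := by
      rw [← h2, hd]
      exact pow_gcd_eq_one.2 ⟨h1, pow_card_sub_one_eq_one _ (div_ne_zero hu hs0)⟩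
    rw [div_pow, div_eq_one_iff_eq (pow_ne_zero _ hs0), ← hs] at h2'
    exact hua h2'
  · rintro ⟨⟨u, hu, rfl⟩, h⟩
    by_cases hua : u ^ 2 = a
    · have hd3 : d ≠ 2 := fun e => h ⟨⟨e, u, by rw [← hua, sq]⟩, by rw [← hua, half]⟩
      obtain ⟨ζ, hζ0, hζ⟩ := exists_orderOf_eq (F := F) (k := d) ⟨m, hm.symm⟩
      have hζn : ζ ^ n = 1 := orderOf_dvd_iff_pow_eq_one.1 (by
        rw [hζ, hd]; exact Nat.gcd_dvd_left _ _)
      refine ⟨u * ζ, mul_ne_zero hu hζ0, ?_, by rw [mul_pow, hζn, mul_one]⟩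
      rw [mul_pow, hua]
      intro e
      have h2 : ζ ^ 2 = 1 := (mul_eq_left₀ ha).1 e
      have := Nat.le_of_dvd two_pos (orderOf_dvd_of_pow_eq_one h2)
      omega
    · exact ⟨u, hu, hua, rfl⟩

theorem exists_add_div_eq_iff_isSquare {F : Type*} [Field F] (h2 : (2 : F) ≠ 0) {a : F}
    (ha : a ≠ 0) (x : F) :
    (∃ u : F, u ≠ 0 ∧ u ^ 2 ≠ a ∧ u + a / u = x) ↔
      x ^ 2 - 4 * a ≠ 0 ∧ IsSquare (x ^ 2 - 4 * a) := by
  constructor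
  · rintro ⟨u, hu, hua, rfl⟩
    have e : (u + a / u) ^ 2 - 4 * a = (u - a / u) * (u - a / u) := by
      field_simp
      ring
    refine ⟨?_, _, e⟩
    rw [e]
    refine mul_self_ne_zero.2 fun h => hua ?_
    rw [sub_eq_zero, eq_div_iff hu, ← sq] at h
    exact h
  · rintro ⟨h0, r, hr⟩
    have hr0 : r ≠ 0 := by rintro rfl; simp [hr] at h0
    have hmul : (x + r) / 2 * ((x - r) / 2) = a := by
      field_simp
      linear_combination hr
    have hu : (x + r) / 2 ≠ 0 := by
      intro h
      rw [h, zero_mul] at hmul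
      exact ha hmul.symm
    have hdiv : a / ((x + r) / 2) = (x - r) / 2 := by
      rw [div_eq_iff hu, mul_comm, hmul]
    refine ⟨(x + r) / 2, hu, fun h => hr0 ?_, ?_⟩
    · rw [← hmul, sq] at h
      have := mul_left_cancel₀ hu h
      field_simp at this
      have h3 : 2 * r = 0 := by linear_combination this
      exact (mul_eq_zero.1 h3).resolve_left h2
    · rw [hdiv]
      field_simp
      ring

theorem sum_image_dickson_hyperbolic (h2 : (2 : F) ≠ 0) {a : F} (ha : a ≠ 0) {n m d : ℕ}
    (hn : Even n) (hd2 : 2 ≤ d) (hd : d = Nat.gcd n (Fintype.card F - 1))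
    (hm : d * m = Fintype.card F - 1) :
    ∑ y ∈ Finset.image (fun x : F => eval x (dickson 1 a n))
        (Finset.filter (fun x : F => x ^ 2 - 4 * a ≠ 0 ∧ IsSquare (x ^ 2 - 4 * a))
          Finset.univ), y =
      ∑ w : F with w ^ m = 1, w + ((if (a ^ (n / 2)) ^ m = 1 then a ^ (n / 2) else 0) +
        (if (-a ^ (n / 2)) ^ m = 1 then -a ^ (n / 2) else 0)) -
        (if d = 2 ∧ IsSquare a then 2 * a ^ (n / 2) else 0) := by
  have hpos : 0 < Fintype.card F - 1 := Nat.sub_pos_of_lt Fintype.one_lt_card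
  have hm0 : m ≠ 0 := by rintro rfl; omega
  set b := a ^ (n / 2) with hb
  have hb0 : b ≠ 0 := pow_ne_zero _ ha
  have hbA : b ^ 2 = a ^ n := by rw [hb, ← pow_mul, Nat.div_mul_cancel hn.two_dvd]
  have hAm : (a ^ n) ^ m = 1 := (exists_ne_zero_pow_eq_iff hd hm _).1 ⟨a, ha, rfl⟩
  have hbm : IsSquare a → b ^ m = 1 := by
    rintro ⟨s, rfl⟩
    refine (exists_ne_zero_pow_eq_iff hd hm _).1 ⟨s, by rintro rfl; simp at ha, ?_⟩
    rw [hb, ← sq, ← pow_mul, Nat.mul_div_cancel' hn.two_dvd]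
  set S : Finset F :=
    Finset.univ.filter fun w => w ^ m = 1 ∧ ¬ ((d = 2 ∧ IsSquare a) ∧ w = b) with hS
  have himage : Finset.image (fun x : F => eval x (dickson 1 a n))
        (Finset.filter (fun x : F => x ^ 2 - 4 * a ≠ 0 ∧ IsSquare (x ^ 2 - 4 * a))
          Finset.univ) = S.image (fun w => w + a ^ n / w) := by
    ext y
    simp only [Finset.mem_image, hS, Finset.mem_filter, Finset.mem_univ, true_and,
      ← exists_add_div_eq_iff_isSquare h2 ha, hb, ← exists_sq_ne_pow_eq_iff ha hn hd2 hd hm]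
    constructor
    · rintro ⟨_, ⟨u, hu, hua, rfl⟩, rfl⟩
      refine ⟨_, ⟨u, hu, hua, rfl⟩, ?_⟩
      rw [eval_dickson_one_add (mul_div_cancel₀ a hu), div_pow]
    · rintro ⟨_, ⟨u, hu, hua, rfl⟩, rfl⟩
      refine ⟨_, ⟨u, hu, hua, rfl⟩, ?_⟩
      rw [eval_dickson_one_add (mul_div_cancel₀ a hu), div_pow]
  have hne : b ≠ -b := fun h => by
    have : 2 * b = 0 := by linear_combination h
    exact hb0 ((mul_eq_zero.1 this).resolve_left h2)
  have hpair : ∑ w : F with w ^ m = 1 ∧ w ^ 2 = a ^ n, w =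
      (if b ^ m = 1 then b else 0) + (if (-b) ^ m = 1 then -b else 0) := by
    have : (Finset.univ.filter fun w : F => w ^ m = 1 ∧ w ^ 2 = a ^ n) =
        ({b, -b} : Finset F).filter fun w => w ^ m = 1 := by
      ext w
      simp [← hbA, sq_eq_sq_iff_eq_or_eq_neg, and_comm]
    rw [this, Finset.sum_filter, Finset.sum_pair hne]
  rw [himage, sum_image_add_div_s12 (pow_ne_zero _ ha), ← hpair]
  · by_cases hP : d = 2 ∧ IsSquare a
    · have e1 : S = (Finset.univ.filter fun w : F => w ^ m = 1).erase b := by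
        ext w
        simp [hS, hP, and_comm]
      have e2 : S.filter (fun w => w ^ 2 = a ^ n) =
          (Finset.univ.filter fun w : F => w ^ m = 1 ∧ w ^ 2 = a ^ n).erase b := by
        ext w
        simp [hS, hP]
        tauto
      rw [e2, e1, Finset.sum_erase_eq_sub (by simp [hbm hP.2]),
        Finset.sum_erase_eq_sub (by simp [hbm hP.2, hbA]), if_pos hP]
      ring
    · rw [if_neg hP, sub_zero, Finset.filter_filter]
      simp only [hS, hP, false_and, not_false_eq_true, and_true]
  · intro w hw h0
    simp [hS, h0, hm0] at hw
  · intro w hw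
    simp only [hS, Finset.mem_filter, Finset.mem_univ, true_and] at hw ⊢
    have hw0 : w ≠ 0 := by rintro rfl; simp [hm0] at hw
    refine ⟨by rw [div_pow, hAm, hw.1, div_one], fun h => hw.2 ⟨h.1, ?_⟩⟩
    have := h.2
    rw [← hbA, div_eq_iff hw0, sq] at this
    exact (mul_left_cancel₀ hb0 this).symm

end FiniteField

/-- The sum of the distinct values of `D_n(·,a)` on the hyperbolic set. -/
theorem hyperbolic_image_sum {F : Type*} [Field F] [Fintype F]
    {q : ℕ} (hF : Fintype.card F = q) (hq : Odd q) (hq3 : 3 < q)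
    (a : F) (ha : a ≠ 0) (n : ℕ) (hn : Even n)
    (d : ℕ) (hd : d = Nat.gcd n (q - 1)) :
    ∑ y ∈ Finset.image (fun x : F => Polynomial.eval x (Polynomial.dickson 1 a n))
        (Finset.filter (fun x : F => x ^ 2 - 4 * a ≠ 0 ∧ IsSquare (x ^ 2 - 4 * a))
          Finset.univ), y =
      if d = q - 1 then 2 * (a ^ ((q - 1) / 2)) ^ (n / d) * a ^ (n / 2)
      else if ¬ IsSquare a then
        (if Even ((q - 1) / d) then 0 else (-1 : F) ^ (n / d) * a ^ (n / 2))
      else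
        if Odd ((q - 1) / d) ∧ d = 2 then -(a ^ (n / 2))
        else if Odd ((q - 1) / d) ∧ d ≠ 2 then a ^ (n / 2)
        else if Even ((q - 1) / d) ∧ d = 2 then -(2 * a ^ (n / 2))
        else 0 := by
  subst hF
  have hchar : ringChar F ≠ 2 := fun h => by
    have := FiniteField.even_card_of_char_two h
    obtain ⟨k, hk⟩ := hq
    omega
  have h2 : (2 : F) ≠ 0 := Ring.two_ne_zero hchar
  obtain ⟨l, hl⟩ := hq
  have hdvd : 2 ∣ d := hd ▸ Nat.dvd_gcd hn.two_dvd ⟨l, by omega⟩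
  have hdn : d ∣ n := hd ▸ Nat.gcd_dvd_left _ _
  have hdq : d ∣ Fintype.card F - 1 := hd ▸ Nat.gcd_dvd_right _ _
  have hd0 : 0 < d := Nat.pos_of_dvd_of_pos hdq (by omega)
  have hd2 : 2 ≤ d := Nat.le_of_dvd hd0 hdvd
  have hm : d * ((Fintype.card F - 1) / d) = Fintype.card F - 1 := Nat.mul_div_cancel' hdq
  rw [FiniteField.sum_image_dickson_hyperbolic h2 ha hn hd2 hd hm]
  set m := (Fintype.card F - 1) / d with hmdef
  set b := a ^ (n / 2) with hb
  have hlhalf : (Fintype.card F - 1) / 2 = l := by omega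
  have hcard : Fintype.card F / 2 = l := by omega
  have hbm : b ^ m = (a ^ l) ^ (n / d) := by
    rw [hb, ← pow_mul, ← pow_mul]
    congr 1
    obtain ⟨k, hk⟩ := hdn
    obtain ⟨e, he⟩ := hdvd
    have h1 : n / 2 = e * k := by
      rw [hk, he, mul_assoc, Nat.mul_div_cancel_left _ two_pos]
    have h3 : n / d = k := by rw [hk, Nat.mul_div_cancel_left _ hd0]
    have h4 : e * m = l := by
      have : 2 * (e * m) = 2 * l := by rw [← mul_assoc, ← he, hm]; omega
      omega
    rw [h1, h3, ← h4]
    ring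
  have hsq : IsSquare a ↔ a ^ l = 1 := hcard ▸ FiniteField.isSquare_iff hchar ha
  have hdich : a ^ l = 1 ∨ a ^ l = -1 := hcard ▸ FiniteField.pow_dichotomy hchar ha
  have hneg : (-1 : F) ≠ 1 := Ring.neg_one_ne_one_of_char_ne_two hchar
  have hsgn : (-1 : F) ^ (n / d) = 1 ∨ (-1 : F) ^ (n / d) = -1 := neg_one_pow_eq_or F _
  by_cases hdq' : d = Fintype.card F - 1
  · have hm1 : m = 1 := by rw [hmdef, ← hdq', Nat.div_self hd0]
    rw [if_pos hdq', hlhalf, ← hbm, hm1, if_neg (by omega : ¬ (d = 2 ∧ IsSquare a))]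
    have hb2 : b * b = 1 := by
      rw [hm1, pow_one] at hbm
      rw [hbm, ← mul_pow, ← sq]
      rcases hdich with h | h <;> simp [h]
    have hsum : ∑ w : F with w ^ 1 = 1, w = 1 := by simp [Finset.sum_filter]
    rw [hsum, pow_one, pow_one, mul_assoc, hb2]
    rcases mul_self_eq_one_iff.1 hb2 with h | h <;> rw [h] <;> simp [hneg] <;> norm_num
  · have hm1 : m ≠ 1 := fun h => hdq' (by rw [← hm, h, mul_one])
    rw [if_neg hdq', FiniteField.sum_pow_eq_one_eq_zero ⟨d, by rw [← hm, mul_comm]⟩ hm1, zero_add]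
    by_cases hs : IsSquare a
    · rw [hsq.1 hs, one_pow] at hbm
      rcases Nat.even_or_odd m with he | ho
      · have : ¬ Odd m := Nat.not_odd_iff_even.2 he
        by_cases hd' : d = 2 <;> simp [hs, he, this, he.neg_pow, hbm, hd']
      · have : ¬ Even m := Nat.not_even_iff_odd.2 ho
        by_cases hd' : d = 2 <;> simp [hs, ho, ho.neg_pow, hbm, hd', hneg]
        ring
    · rw [hdich.resolve_left (mt hsq.2 hs)] at hbm
      rcases Nat.even_or_odd m with he | ho
      · rcases hsgn with h | h <;> simp [hs, he, he.neg_pow, hbm, h, hneg]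
      · have : ¬ Even m := Nat.not_even_iff_odd.2 ho
        rcases hsgn with h | h <;> simp [hs, this, ho.neg_pow, hbm, h, hneg]
end

section
/- Let q be an odd prime power with q > 3, F a finite field with q elements, a ∈ F with a ≠ 0, and n an even natural number. Set δ = gcd(n, q+1). Then the number of distinct values taken by D_n(·,a) on the elliptic set E_q(a) = {x ∈ F : x² − 4a is a nonsquare} equals ⌊(q+1)/(2δ)⌋ + c, where c = 1 if either (a is a nonsquare in F and (q+1)/δ is odd) or (a is a square in F and δ ≠ 2), and c = 0 otherwise. -/
open Polynomial
open scoped Classical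

/-- The functional equation of Dickson polynomials of the first kind. -/
lemma eval_add_dickson_one_mul {R : Type*} [CommRing R] (y b : R) (n : ℕ) :
    (dickson 1 (y * b) n).eval (y + b) = y ^ n + b ^ n := by
  induction n using Nat.twoStepInduction with
  | zero => simp [dickson_zero]; norm_num
  | one => simp
  | more n ih₁ ih₂ =>
    simp only [dickson_add_two, eval_sub, eval_mul, eval_X, eval_C, ih₁, ih₂]
    ring

/-- An extension element fixed by the Frobenius of a finite field lies in that field. -/
lemma mem_range_algebraMap_of_pow_card_eq_self {F K : Type*} [Field F] [Fintype F] [Field K]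
    [Algebra F K] {x : K} (hx : x ^ Fintype.card F = x) : ∃ z : F, algebraMap F K z = x := by
  have h1 : 1 < Fintype.card F := Fintype.one_lt_card
  have hs : (X ^ Fintype.card F - X : F[X]).Splits := by
    rw [splits_iff_card_roots, FiniteField.roots_X_pow_card_sub_X,
      FiniteField.X_pow_card_sub_X_natDegree_eq F h1]
    rfl
  exact hs.mem_range_of_isRoot (FiniteField.X_pow_card_sub_X_ne_zero F h1)
    (i := algebraMap F K) (by simp [hx])

lemma algebraMap_pow_card {F K : Type*} [Field F] [Fintype F] [Field K] [Algebra F K] (z : F) :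
    algebraMap F K z ^ Fintype.card F = algebraMap F K z := by
  rw [← map_pow, FiniteField.pow_card]

lemma two_ne_zero_of_odd_card {F : Type*} [Field F] [Fintype F] (hq : Odd (Fintype.card F)) :
    (2 : F) ≠ 0 := by
  intro h
  obtain ⟨k, hk⟩ := hq
  have h0 := Nat.cast_card_eq_zero F
  rw [hk] at h0
  push_cast at h0
  rw [h] at h0
  simp at h0

/-- Parametrization of the elliptic set by the elements of norm `a`. -/
lemma mem_elliptic_image_iff {F K : Type*} [Field F] [Fintype F] [Field K] [Algebra F K]
    [IsAlgClosed K] (hq : Odd (Fintype.card F)) {a : F} (ha : a ≠ 0) (w : K) :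
    w ∈ algebraMap F K '' {x : F | ¬ IsSquare (x ^ 2 - 4 * a)} ↔
      ∃ y : K, y ^ (Fintype.card F + 1) = algebraMap F K a ∧ y ^ 2 ≠ algebraMap F K a ∧
        y + algebraMap F K a / y = w := by
  set φ := algebraMap F K with hφ
  have hφi : Function.Injective φ := φ.injective
  have h2 : (2 : K) ≠ 0 := by
    rw [← map_ofNat φ 2]
    exact (_root_.map_ne_zero φ).2 (two_ne_zero_of_odd_card hq)
  have haK : φ a ≠ 0 := (_root_.map_ne_zero φ).2 ha
  have hfrob : ∀ x y : K, (x + y) ^ Fintype.card F = x ^ Fintype.card F + y ^ Fintype.card F :=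
    fun x y => map_add (FiniteField.frobeniusAlgHom F K) x y
  have hfsub : ∀ x y : K, (x - y) ^ Fintype.card F = x ^ Fintype.card F - y ^ Fintype.card F :=
    fun x y => map_sub (FiniteField.frobeniusAlgHom F K) x y
  constructor
  · rintro ⟨x, hx, rfl⟩
    obtain ⟨s, hs⟩ := IsAlgClosed.exists_pow_nat_eq (φ x ^ 2 - 4 * φ a) (n := 2) (by norm_num)
    obtain ⟨y, hy⟩ : ∃ y : K, 2 * y = φ x + s := ⟨(φ x + s) / 2, by field_simp⟩
    have hquad : y * (φ x - y) = φ a := by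
      have : (2 * 2 : K) * (y * (φ x - y)) = 2 * 2 * φ a := by
        linear_combination (2 * φ x - 2 * y - (φ x + s)) * hy - hs
      exact mul_left_cancel₀ (mul_ne_zero h2 h2) this
    have hy0 : y ≠ 0 := by rintro rfl; rw [zero_mul] at hquad; exact haK hquad.symm
    have hnF : y ^ Fintype.card F ≠ y := by
      intro h
      obtain ⟨z, hz⟩ := mem_range_algebraMap_of_pow_card_eq_self h
      refine hx ⟨2 * z - x, hφi ?_⟩
      simp only [map_sub, map_mul, map_pow, map_ofNat]
      rw [hz]
      linear_combination 4 * hquad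
    have hquad' : y ^ Fintype.card F * (φ x - y ^ Fintype.card F) = φ a := by
      have := congrArg (· ^ Fintype.card F) hquad
      simpa only [mul_pow, hfsub, hφ, algebraMap_pow_card] using this
    have hconj : y ^ Fintype.card F = φ x - y := by
      have : (y ^ Fintype.card F - y) * (y ^ Fintype.card F - (φ x - y)) = 0 := by
        linear_combination hquad - hquad'
      rcases mul_eq_zero.1 this with h | h
      · exact absurd (sub_eq_zero.1 h) hnF
      · exact sub_eq_zero.1 h
    have hnorm : y ^ (Fintype.card F + 1) = φ a := by
      rw [pow_succ, hconj, mul_comm, hquad]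
    refine ⟨y, hnorm, fun h => hnF ?_, ?_⟩
    · apply mul_right_cancel₀ hy0
      rw [← pow_succ, hnorm, ← h, sq]
    · rw [← hquad]; field_simp; ring
  · rintro ⟨y, hy, hya, rfl⟩
    have hy0 : y ≠ 0 := by
      rintro rfl
      rw [zero_pow (Nat.succ_ne_zero _)] at hy
      exact haK hy.symm
    have hconj : y ^ Fintype.card F = φ a / y := by
      rw [eq_div_iff hy0, ← pow_succ, hy]
    have hnF : ∀ z, φ z ≠ y := by
      rintro z rfl
      rw [hφ, algebraMap_pow_card, ← hφ, eq_div_iff hy0] at hconj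
      exact hya (by rw [sq, hconj])
    obtain ⟨x, hx⟩ := mem_range_algebraMap_of_pow_card_eq_self (F := F) (x := y + φ a / y) (by
      rw [hfrob, div_pow, hconj, hφ, algebraMap_pow_card, ← hφ]
      field_simp
      ring)
    rw [← hφ] at hx
    refine ⟨x, ?_, hx⟩
    rintro ⟨z, hz⟩
    have hz' : (y - φ a / y) ^ 2 = φ z ^ 2 := by
      have := congrArg φ hz
      simp only [map_sub, map_mul, map_pow, map_ofNat, hx] at this
      rw [sq (φ z), ← this]
      field_simp
      ring
    have h2F := two_ne_zero_of_odd_card hq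
    rcases sq_eq_sq_iff_eq_or_eq_neg.1 hz' with h | h
    · refine hnF ((x + z) / 2) ?_
      rw [map_div₀, map_add, hx, ← h, map_ofNat]
      field_simp
      ring
    · refine hnF ((x - z) / 2) ?_
      rw [map_div₀, map_sub, hx, sub_eq_add_neg, ← h, map_ofNat]
      field_simp
      ring

/-- A square root of `a`, up to a fixed generator of the norm-one group, of norm `a`. -/
lemma exists_norm_eq_sq_eq {F K : Type*} [Field F] [Fintype F] [Field K] [Algebra F K]
    [IsAlgClosed K] {a : F} (ha : a ≠ 0) {u : K}
    (hu : IsPrimitiveRoot u (Fintype.card F + 1)) :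
    ∃ y : K, y ^ (Fintype.card F + 1) = algebraMap F K a ∧
      y ^ 2 = algebraMap F K a * u ^ (if IsSquare a then 0 else 1) := by
  set φ := algebraMap F K with hφ
  have haK : φ a ≠ 0 := (_root_.map_ne_zero φ).2 ha
  split_ifs with hsq
  · obtain ⟨b, rfl⟩ := hsq
    refine ⟨φ b, ?_, ?_⟩
    · rw [pow_succ, hφ, algebraMap_pow_card, map_mul]
    · rw [map_mul, pow_zero, mul_one, sq]
  · obtain ⟨y, hy⟩ := IsAlgClosed.exists_pow_nat_eq (φ a) (Nat.succ_pos (Fintype.card F))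
    have hy0 : y ≠ 0 := by
      rintro rfl
      rw [zero_pow (Nat.succ_ne_zero _)] at hy
      exact haK hy.symm
    have hu0 : u ≠ 0 := hu.ne_zero (Nat.succ_ne_zero _)
    have hun : (y ^ 2 / φ a) ^ (Fintype.card F + 1) = 1 := by
      have hcard : φ a ^ (Fintype.card F + 1) = φ a ^ 2 := by
        rw [pow_succ, hφ, algebraMap_pow_card, sq]
      rw [div_pow, ← pow_mul, mul_comm, pow_mul, hy, hcard, div_self (pow_ne_zero _ haK)]
    obtain ⟨e, -, he⟩ := hu.eq_pow_of_pow_eq_one hun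
    have hye : y ^ 2 = φ a * u ^ e := by rw [he]; field_simp
    have hnorm : ∀ j : ℕ, (y / u ^ j) ^ (Fintype.card F + 1) = φ a := fun j => by
      rw [div_pow, hy, ← pow_mul, mul_comm, pow_mul, hu.pow_eq_one, one_pow, div_one]
    obtain ⟨j, rfl | rfl⟩ := Nat.even_or_odd' e
    · exfalso
      have h2 : (y / u ^ j) ^ 2 = φ a := by
        rw [div_pow, hye]; field_simp; ring
      have hyj : y / u ^ j ≠ 0 := div_ne_zero hy0 (pow_ne_zero _ hu0)
      obtain ⟨z, hz⟩ := mem_range_algebraMap_of_pow_card_eq_self (F := F) (x := y / u ^ j) (by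
        apply mul_right_cancel₀ hyj
        rw [← pow_succ, hnorm, ← sq, h2])
      refine hsq ⟨z, φ.injective ?_⟩
      rw [map_mul, hz, ← sq, h2]
    · refine ⟨y / u ^ j, hnorm j, ?_⟩
      rw [div_pow, hye]; field_simp; ring

/-- The numbers `0 ≤ k ≤ m` of parity `e`, with `0` removed if `P` holds. -/
lemma card_filter_parity (m e : ℕ) (he : e < 2) (P : Prop) [Decidable P] :
    ((Finset.range (m + 1)).filter (fun k => k % 2 = e ∧ ¬ (k = 0 ∧ P))).card =
      (m + 2 - e) / 2 - (if e = 0 ∧ P then 1 else 0) := by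
  induction m with
  | zero =>
    by_cases hP : P
    · have : e = 0 ∨ e = 1 := by omega
      rcases this with rfl | rfl <;> simp [hP]
    · have : e = 0 ∨ e = 1 := by omega
      rcases this with rfl | rfl <;> simp [hP, Finset.filter_singleton]
  | succ m ih =>
    rw [Finset.range_add_one, Finset.filter_insert]
    split_ifs at ih ⊢ <;> first
      | (rw [Finset.card_insert_of_notMem (by simp), ih]; omega)
      | (rw [ih]; grind)

/-- Every integer is, up to sign, congruent modulo `2 * m` to some `0 ≤ k ≤ m`. -/
lemma exists_le_dvd_sub_or_dvd_add {m : ℕ} (hm : 0 < m) (s : ℤ) :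
    ∃ k : ℕ, k ≤ m ∧ ((2 * m : ℤ) ∣ s - k ∨ (2 * m : ℤ) ∣ s + k) := by
  have h0 := Int.emod_nonneg s (b := 2 * m) (by omega)
  have h1 := Int.emod_lt_of_pos s (b := 2 * m) (by omega)
  have h2 := Int.mul_ediv_add_emod s (2 * m)
  set r := s % (2 * m)
  by_cases h : r ≤ m
  · exact ⟨r.toNat, by omega, .inl ⟨s / (2 * m), by rw [Int.toNat_of_nonneg h0]; linarith⟩⟩
  · refine ⟨(2 * m - r).toNat, by omega, .inr ⟨s / (2 * m) + 1, ?_⟩⟩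
    rw [Int.toNat_of_nonneg (by omega)]
    linarith

lemma eq_of_zpow_add_zpow_neg_eq {K : Type*} [Field K] {v : K} {m : ℕ} (hm : 0 < m)
    (hv : IsPrimitiveRoot v (2 * m)) {k l : ℕ} (hk : k ≤ m) (hl : l ≤ m)
    (h : v ^ (k : ℤ) + v ^ (-k : ℤ) = v ^ (l : ℤ) + v ^ (-l : ℤ)) : k = l := by
  have hv0 : v ≠ 0 := hv.ne_zero (by omega)
  have hprod : (v ^ (k : ℤ) - v ^ (l : ℤ)) * (v ^ (k : ℤ) * v ^ (l : ℤ) - 1) = 0 := by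
    rw [zpow_neg, zpow_neg] at h
    have := zpow_ne_zero (k : ℤ) hv0
    have := zpow_ne_zero (l : ℤ) hv0
    field_simp at h
    linear_combination h
  rcases mul_eq_zero.1 hprod with h | h
  · have h1 : v ^ ((k : ℤ) - l) = 1 := by
      rw [zpow_sub₀ hv0, sub_eq_zero.1 h, div_self (zpow_ne_zero _ hv0)]
    rw [hv.zpow_eq_one_iff_dvd] at h1
    push_cast at h1
    have := Int.eq_zero_of_abs_lt_dvd h1 (by rw [abs_lt]; omega)
    omega
  · rw [← zpow_add₀ hv0, sub_eq_zero, hv.zpow_eq_one_iff_dvd] at h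
    have h : 2 * m ∣ k + l := by exact_mod_cast h
    rcases Nat.eq_zero_or_pos (k + l) with h0 | h0
    · omega
    · have := Nat.le_of_dvd h0 h
      omega

/-- If `t` is coprime to `m`, multiplication by `t` maps the integers of parity `ε` onto the
residues modulo `2 * m` of parity `t * ε`. -/
lemma exists_mul_congr {D m t ε : ℕ} (hm : 0 < m) (ht : Nat.Coprime t m) (hε : ε < 2) {k : ℕ}
    (hk : k ≤ m) (hpar : k % 2 = t * ε % 2) (hk0 : ¬ (k = 0 ∧ ε = 0 ∧ D = 1)) :
    ∃ j : ℤ, (2 * m : ℤ) ∣ t * (ε + 2 * j) - k ∧ ¬ ((2 * D * m : ℤ) ∣ ε + 2 * j) := by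
  obtain ⟨l, hl⟩ : ∃ l : ℤ, (k : ℤ) - t * ε = 2 * l := ⟨(k - t * ε) / 2, by
    have : ((k : ℤ) - t * ε) % 2 = 0 := by
      have : (k : ℤ) % 2 = (t * ε : ℤ) % 2 := by exact_mod_cast hpar
      omega
    omega⟩
  obtain ⟨x, z, hxz⟩ : IsCoprime (t : ℤ) m := Nat.isCoprime_iff_coprime.2 ht
  have hcong : ∀ i : ℤ, (2 * m : ℤ) ∣ t * (ε + 2 * (x * l + m * i)) - k := fun i =>
    ⟨t * i - z * l, by linear_combination 2 * l * hxz - hl⟩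
  by_cases hbad : ∀ i : ℤ, (2 * D * m : ℤ) ∣ ε + 2 * (x * l + m * i)
  · exfalso
    have h0 := hbad 0
    have hε0 : ε = 0 := by
      have : (2 : ℤ) ∣ ε + 2 * (x * l + m * 0) := ((dvd_mul_right 2 (D : ℤ)).mul_right _).trans h0
      omega
    have hD : D = 1 := by
      have h1 := dvd_sub (hbad 1) h0
      have h2 : (2 * m : ℤ) * D ∣ (2 * m : ℤ) * 1 := by
        have h3 : (ε + 2 * (x * l + m * 1) - (ε + 2 * (x * l + m * 0)) : ℤ) = 2 * m * 1 := by ring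
        rwa [h3, mul_right_comm] at h1
      have := Int.dvd_of_mul_dvd_mul_left (by omega) h2
      exact Nat.dvd_one.1 (by exact_mod_cast this)
    subst hε0 hD
    have h3 : (2 * m : ℤ) ∣ k := by
      have h1 := hcong 0
      have h2 := (Dvd.dvd.mul_left h0 (t : ℤ))
      rw [Nat.cast_one, mul_one] at h2
      simpa only [sub_sub_cancel] using dvd_sub h2 h1
    have h4 : 2 * m ∣ k := by exact_mod_cast h3
    have := Nat.eq_zero_of_dvd_of_lt h4 (by omega)
    exact hk0 ⟨this, rfl, rfl⟩
  · push Not at hbad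
    obtain ⟨i, hi⟩ := hbad
    exact ⟨_, hcong i, hi⟩

/-- The values of `y ^ n + (a / y) ^ n` over elements `y` of norm `a` not fixed by Frobenius,
listed without repetition. -/
lemma image_norm_eq {K : Type*} [Field K] {N D m t ε : ℕ} (hD : 0 < D) (hm : 0 < m)
    (hN : N = 2 * D * m) (ht : Nat.Coprime t m) (hε : ε < 2) {a u y₀ : K} (ha : a ≠ 0)
    (hu : IsPrimitiveRoot u N) (hy₀ : y₀ ^ N = a) (hy₀' : y₀ ^ 2 = a * u ^ ε) :
    {w : K | ∃ y : K, y ^ N = a ∧ y ^ 2 ≠ a ∧ y ^ (2 * D * t) + (a / y) ^ (2 * D * t) = w} =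
      (fun k : ℕ => a ^ (D * t) * ((u ^ D) ^ (k : ℤ) + (u ^ D) ^ (-k : ℤ))) ''
        ((Finset.range (m + 1)).filter
          (fun k => k % 2 = t * ε % 2 ∧ ¬ (k = 0 ∧ ε = 0 ∧ D = 1)) : Finset ℕ) := by
  have hN0 : 0 < N := by rw [hN]; positivity
  have : NeZero N := ⟨hN0.ne'⟩
  have hu0 : u ≠ 0 := hu.ne_zero hN0.ne'
  have hv : IsPrimitiveRoot (u ^ D) (2 * m) := hu.pow hN0 (by rw [hN]; ring)
  have hv0 : u ^ D ≠ 0 := pow_ne_zero _ hu0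
  have hy₀0 : y₀ ≠ 0 := by
    rintro rfl
    rw [zero_pow hN0.ne'] at hy₀
    exact ha hy₀.symm
  have hpow : ∀ (x : K) (s : ℤ), x ^ 2 = a * u ^ s →
      x ^ (2 * D * t) = a ^ (D * t) * (u ^ D) ^ (t * s) := fun x s hx => by
    rw [mul_assoc, pow_mul, hx, mul_pow]
    congr 1
    rw [← zpow_natCast, ← zpow_natCast, ← zpow_mul, ← zpow_mul]
    congr 1
    push_cast
    ring
  have hsq : ∀ j : ℤ, (y₀ * u ^ j) ^ 2 = a * u ^ (ε + 2 * j) := fun j => by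
    rw [mul_pow, hy₀', zpow_add₀ hu0, zpow_natCast, mul_comm 2 j, zpow_mul, mul_assoc,
      zpow_ofNat]
  have hval : ∀ j : ℤ, (y₀ * u ^ j) ^ (2 * D * t) + (a / (y₀ * u ^ j)) ^ (2 * D * t) =
      a ^ (D * t) * ((u ^ D) ^ (t * (ε + 2 * j)) + (u ^ D) ^ (-(t * (ε + 2 * j)))) := fun j => by
    rw [hpow _ _ (hsq j), hpow (a / (y₀ * u ^ j)) (-(ε + 2 * j)), mul_neg, ← mul_add]
    rw [div_pow, hsq, zpow_neg]
    have := zpow_ne_zero (ε + 2 * j) hu0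
    field_simp
  have hne : ∀ j : ℤ, (y₀ * u ^ j) ^ 2 ≠ a ↔ ¬ ((2 * D * m : ℤ) ∣ ε + 2 * j) := fun j => by
    rw [hsq, Ne, mul_eq_left₀ ha, hu.zpow_eq_one_iff_dvd, hN]
    push_cast
    rfl
  have hcongr : ∀ s r : ℤ, (2 * m : ℤ) ∣ s - r → (u ^ D) ^ s = (u ^ D) ^ r := fun s r h => by
    have : (u ^ D) ^ (s - r) = 1 := (hv.zpow_eq_one_iff_dvd _).2 (by exact_mod_cast h)
    rw [zpow_sub₀ hv0, div_eq_one_iff_eq (zpow_ne_zero _ hv0)] at this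
    exact this
  have hcongr' : ∀ s r : ℤ, (2 * m : ℤ) ∣ s - r →
      (u ^ D) ^ s + (u ^ D) ^ (-s) = (u ^ D) ^ r + (u ^ D) ^ (-r) := fun s r h => by
    rw [zpow_neg, zpow_neg, hcongr s r h]
  ext w
  simp only [Set.mem_ofPred_eq, Set.mem_image, Finset.coe_filter, Finset.mem_range]
  constructor
  · rintro ⟨y, hy, hya, rfl⟩
    obtain ⟨i, -, hi⟩ := hu.eq_pow_of_pow_eq_one (ξ := y / y₀)
      (by rw [div_pow, hy, hy₀, div_self ha])
    obtain rfl : y = y₀ * u ^ (i : ℤ) := by rw [zpow_natCast, hi]; field_simp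
    rw [hval]
    rw [hne] at hya
    obtain ⟨k, hk, hdvd⟩ := exists_le_dvd_sub_or_dvd_add hm (t * (ε + 2 * (i : ℤ)))
    refine ⟨k, ⟨by omega, ?_, ?_⟩, ?_⟩
    · have hpar : (k : ℤ) % 2 = (t * ε : ℤ) % 2 := by
        have h2 : (2 : ℤ) ∣ 2 * m := ⟨m, rfl⟩
        have h3 : (t * (ε + 2 * (i : ℤ)) : ℤ) = t * ε + 2 * (t * i) := by ring
        rw [h3] at hdvd
        rcases hdvd with h | h <;> have := h2.trans h <;> omega
      exact_mod_cast hpar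
    · rintro ⟨rfl, rfl, rfl⟩
      apply hya
      have h1 : (2 * m : ℤ) ∣ 2 * (t * i) := by
        rcases hdvd with h | h <;> · convert h using 1; push_cast; ring
      have h2 : m ∣ t * i := by
        exact_mod_cast Int.dvd_of_mul_dvd_mul_left two_ne_zero h1
      have h3 : (m : ℤ) ∣ i := by exact_mod_cast ht.symm.dvd_of_dvd_mul_left h2
      have := mul_dvd_mul_left 2 h3
      simpa using this
    · rcases hdvd with h | h
      · rw [hcongr' _ _ h]
      · rw [hcongr' (t * (ε + 2 * (i : ℤ))) (-k) (by rwa [sub_neg_eq_add]), neg_neg, add_comm]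
  · rintro ⟨k, ⟨hk, hpar, hk0⟩, rfl⟩
    obtain ⟨j, hj, hj'⟩ := exists_mul_congr hm ht hε (Nat.lt_succ_iff.1 hk) hpar hk0
    refine ⟨y₀ * u ^ j, ?_, (hne j).2 hj', ?_⟩
    · rw [mul_pow, hy₀, ← zpow_natCast (u ^ j), ← zpow_mul, mul_comm j, zpow_mul, zpow_natCast,
        hu.pow_eq_one, one_zpow, mul_one]
    · rw [hval, hcongr' _ _ hj]

/-- The number of distinct values of `D_n(·,a)` on the elliptic set. -/
theorem elliptic_image_card {F : Type*} [Field F] [Fintype F]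
    {q : ℕ} (hF : Fintype.card F = q) (hq : Odd q) (hq3 : 3 < q)
    (a : F) (ha : a ≠ 0) (n : ℕ) (hn : Even n)
    (δ : ℕ) (hδ : δ = Nat.gcd n (q + 1)) :
    Set.ncard ((fun x : F => Polynomial.eval x (Polynomial.dickson 1 a n)) ''
        {x : F | ¬ IsSquare (x ^ 2 - 4 * a)}) =
      (q + 1) / (2 * δ) +
        (if (¬ IsSquare a ∧ Odd ((q + 1) / δ)) ∨ (IsSquare a ∧ δ ≠ 2) then 1 else 0) := by
  subst hF
  set N := Fintype.card F + 1 with hNdef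
  obtain ⟨D, hD⟩ : 2 ∣ δ := hδ ▸ Nat.dvd_gcd hn.two_dvd hq.add_one.two_dvd
  have hδ0 : 0 < δ := hδ ▸ Nat.gcd_pos_of_pos_right _ (Nat.succ_pos _)
  have hD0 : 0 < D := by omega
  obtain ⟨t, m, htm, hnt, hNm⟩ : ∃ t m : ℕ, Nat.Coprime t m ∧ n = 2 * D * t ∧ N = 2 * D * m := by
    obtain ⟨t, m, h1, h2, h3⟩ := Nat.exists_coprime n N
    rw [← hδ, hD] at h2 h3
    exact ⟨t, m, h1, by rw [mul_comm, ← h2], by rw [mul_comm, ← h3]⟩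
  have hm0 : 0 < m := Nat.pos_of_ne_zero (by rintro rfl; simp [hNdef] at hNm)
  let K := AlgebraicClosure F
  have : NeZero (N : F) := ⟨by simp [hNdef]⟩
  obtain ⟨u, hu⟩ := HasEnoughRootsOfUnity.exists_primitiveRoot K N
  obtain ⟨y₀, hy₀, hy₀'⟩ := exists_norm_eq_sq_eq ha hu
  have haK : algebraMap F K a ≠ 0 := (_root_.map_ne_zero _).2 ha
  have himage : algebraMap F K '' ((fun x : F => eval x (dickson 1 a n)) ''
      {x : F | ¬ IsSquare (x ^ 2 - 4 * a)}) =
      {w : K | ∃ y : K, y ^ N = algebraMap F K a ∧ y ^ 2 ≠ algebraMap F K a ∧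
        y ^ (2 * D * t) + (algebraMap F K a / y) ^ (2 * D * t) = w} := by
    have hmap : ∀ x : F, algebraMap F K (eval x (dickson 1 a n)) =
        eval (algebraMap F K x) (dickson 1 (algebraMap F K a) n) := fun x => by
      rw [← map_dickson, eval_map, eval₂_at_apply]
    have heval : ∀ y : K, y ^ N = algebraMap F K a →
        eval (y + algebraMap F K a / y) (dickson 1 (algebraMap F K a) n) =
          y ^ (2 * D * t) + (algebraMap F K a / y) ^ (2 * D * t) := fun y hy => by
      have hy0 : y ≠ 0 := by
        rintro rfl
        rw [zero_pow (Nat.succ_ne_zero _)] at hy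
        exact haK hy.symm
      have := eval_add_dickson_one_mul y (algebraMap F K a / y) n
      rw [mul_div_cancel₀ _ hy0] at this
      rw [this, hnt]
    ext w
    constructor
    · rintro ⟨_, ⟨x, hx, rfl⟩, rfl⟩
      obtain ⟨y, h1, h2, h3⟩ := (mem_elliptic_image_iff (K := K) hq ha _).1 ⟨x, hx, rfl⟩
      exact ⟨y, h1, h2, by rw [hmap, ← h3, heval y h1]⟩
    · rintro ⟨y, h1, h2, rfl⟩
      obtain ⟨x, hx, hxy⟩ := (mem_elliptic_image_iff (K := K) hq ha _).2 ⟨y, h1, h2, rfl⟩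
      exact ⟨_, ⟨x, hx, rfl⟩, by rw [hmap, hxy, heval y h1]⟩
  have hv : IsPrimitiveRoot (u ^ D) (2 * m) := hu.pow (n := N) (Nat.succ_pos _) (by rw [hNm]; ring)
  rw [← Set.ncard_image_of_injective _ (algebraMap F K).injective, himage,
    image_norm_eq hD0 hm0 hNm htm (by split_ifs <;> norm_num) haK hu hy₀ hy₀',
    Set.InjOn.ncard_image, Set.ncard_coe_finset,
    card_filter_parity m _ (Nat.mod_lt _ two_pos) (_ ∧ D = 1)]
  · have hdiv : N / (2 * δ) = m / 2 := by
      rw [hNm, hD, mul_comm 2 (2 * D), Nat.mul_div_mul_left _ _ (by omega)]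
    have hdiv' : N / δ = m := by rw [hNm, hD, Nat.mul_div_cancel_left _ (by omega)]
    rw [hdiv, hdiv', hD]
    by_cases hsq : IsSquare a
    · by_cases hD1 : D = 1
      · simp [hsq, hD1]
      · have : 2 * D ≠ 2 := by omega
        simp [hsq, hD1]
    · have hodd : t % 2 = 0 → m % 2 = 1 := fun h => by
        by_contra hm
        exact Nat.not_coprime_of_dvd_of_dvd one_lt_two (Nat.dvd_of_mod_eq_zero h)
          (Nat.dvd_of_mod_eq_zero (by omega)) htm
      simp only [hsq, if_false, mul_one, one_ne_zero, false_and, and_false, not_false_eq_true,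
        true_and, or_false, Nat.odd_iff]
      split_ifs <;> omega
  · intro k hk l hl hkl
    simp only [Finset.coe_filter, Finset.mem_range, Set.mem_ofPred_eq] at hk hl
    exact eq_of_zpow_add_zpow_neg_eq hm0 hv (by omega) (by omega)
      (mul_left_cancel₀ (pow_ne_zero _ haK) hkl)
end

section
/- Let q be an odd prime power with q > 3, F a finite field with q elements, a ∈ F with a ≠ 0, and n an even natural number. Set δ = gcd(n, q+1) and let χ(a) = a^((q−1)/2). Then the sum in F of the distinct values taken by D_n(·,a) on the elliptic set E_q(a) = {x ∈ F : x² − 4a is a nonsquare} equals: 2·χ(a)^(n/δ)·a^(n/2) if δ = q+1; otherwise, if a is a nonsquare: 0 when (q+1)/δ is even, and (−1)^(n/δ)·a^(n/2) when (q+1)/δ is odd; and if a is a square: −a^(n/2) when (q+1)/δ is odd and δ = 2; a^(n/2) when (q+1)/δ is odd and δ ≠ 2; −2·a^(n/2) when (q+1)/δ is even and δ = 2; and 0 when (q+1)/δ is even and δ ≠ 2. -/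
open Polynomial
open scoped Classical

lemma eval_dickson_one_mul_add {R : Type*} [CommRing R] (u v : R) :
    ∀ n, (dickson 1 (u * v) n).eval (u + v) = u ^ n + v ^ n
  | 0 => by
    simp only [pow_zero, dickson_zero]; norm_num
  | 1 => by simp only [eval_X, dickson_one, pow_one]
  | n + 2 => by
    simp only [eval_sub, eval_mul, eval_dickson_one_mul_add u v _, eval_X, dickson_add_two, eval_C]
    ring

lemma add_inv_eq_add_inv_iff {K : Type*} [Field K] {w z : K} (hw : w ≠ 0) (hz : z ≠ 0) :
    w + w⁻¹ = z + z⁻¹ ↔ w = z ∨ w = z⁻¹ := by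
  constructor
  · intro h
    have : (w - z) * (w * z - 1) = 0 := by
      field_simp at h
      linear_combination h
    rcases mul_eq_zero.1 this with h | h
    · exact .inl (sub_eq_zero.1 h)
    · exact .inr (eq_inv_of_mul_eq_one_left (sub_eq_zero.1 h))
  · rintro (rfl | rfl)
    · rfl
    · rw [inv_inv, add_comm]

/-- The sum of the distinct values of `w + w⁻¹` on a finite set closed under inversion. -/
lemma sum_image_add_inv {K : Type*} [Field K] (h2 : (2 : K) ≠ 0) (W : Finset K)
    (h0 : ∀ w ∈ W, w ≠ 0) (hinv : ∀ w ∈ W, w⁻¹ ∈ W) :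
    ∑ v ∈ W.image (fun w => w + w⁻¹), v =
      ∑ w ∈ W, w + (if 1 ∈ W then 1 else 0) - (if -1 ∈ W then 1 else 0) := by
  have hne : (-1 : K) ≠ 1 := fun h => h2 (by linear_combination -h)
  have hfib : ∀ z ∈ W, ∑ w ∈ W with w + w⁻¹ = z + z⁻¹, w =
      z + z⁻¹ - (if z + z⁻¹ = 1 + 1⁻¹ then 1 else 0)
        + (if z + z⁻¹ = -1 + (-1)⁻¹ then 1 else 0) := by
    intro z hz
    have hf : W.filter (fun w => w + w⁻¹ = z + z⁻¹) = {z, z⁻¹} := by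
      ext w
      simp only [Finset.mem_filter, Finset.mem_insert, Finset.mem_singleton]
      constructor
      · rintro ⟨hw, h⟩
        exact (add_inv_eq_add_inv_iff (h0 w hw) (h0 z hz)).1 h
      · rintro (rfl | rfl)
        · exact ⟨hz, rfl⟩
        · exact ⟨hinv z hz, by rw [inv_inv, add_comm]⟩
    rw [hf, add_inv_eq_add_inv_iff (h0 z hz) one_ne_zero,
      add_inv_eq_add_inv_iff (h0 z hz) (neg_ne_zero.2 one_ne_zero), inv_neg, inv_one, or_self,
      or_self]
    by_cases h1 : z = 1
    · simp [h1, hne.symm]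
    by_cases h3 : z = -1
    · simp [h3, hne]
    have : z ≠ z⁻¹ := by
      intro h
      have hzz : z * z = 1 := by
        nth_rewrite 2 [h]
        exact mul_inv_cancel₀ (h0 z hz)
      rcases mul_self_eq_one_iff.1 hzz with h | h
      · exact h1 h
      · exact h3 h
    rw [Finset.sum_pair this]
    simp [h1, h3]
  have hmem : ∀ c : K, c ≠ 0 → c⁻¹ = c → (c + c⁻¹ ∈ W.image (fun w => w + w⁻¹) ↔ c ∈ W) := by
    intro c hc hcc
    simp only [Finset.mem_image]
    constructor
    · rintro ⟨w, hw, h⟩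
      rw [add_inv_eq_add_inv_iff (h0 w hw) hc, hcc, or_self] at h
      exact h ▸ hw
    · exact fun h => ⟨c, h, rfl⟩
  have key : ∑ w ∈ W, w = ∑ v ∈ W.image (fun w => w + w⁻¹),
      (v - (if v = 1 + 1⁻¹ then 1 else 0) + (if v = -1 + (-1)⁻¹ then 1 else 0)) := by
    rw [← Finset.sum_fiberwise_of_maps_to
      (fun w hw => Finset.mem_image_of_mem (fun w => w + w⁻¹) hw) (fun w => w)]
    refine Finset.sum_congr rfl fun v hv => ?_
    obtain ⟨z, hz, rfl⟩ := Finset.mem_image.1 hv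
    exact hfib z hz
  rw [Finset.sum_add_distrib, Finset.sum_sub_distrib, Finset.sum_ite_eq', Finset.sum_ite_eq'] at key
  simp only [hmem 1 one_ne_zero inv_one, hmem (-1) (neg_ne_zero.2 one_ne_zero) (by simp)] at key
  rw [key]
  ring

lemma sum_nthRootsFinset_eq_zero {K : Type*} [Field K] [IsAlgClosed K] {m : ℕ} (hm : 1 < m)
    (hmK : (m : K) ≠ 0) (s : K) : ∑ w ∈ nthRootsFinset m s, w = 0 := by
  have : NeZero (m : K) := ⟨hmK⟩
  obtain ⟨ζ, hζ⟩ := HasEnoughRootsOfUnity.exists_primitiveRoot K m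
  have hm0 : 0 < m := by lia
  have h : ∑ w ∈ nthRootsFinset m s, ζ * w = ∑ w ∈ nthRootsFinset m s, w := by
    refine Finset.sum_bij' (fun w _ => ζ * w) (fun w _ => ζ⁻¹ * w) ?_ ?_ ?_ ?_ ?_
    · intro w hw
      rw [mem_nthRootsFinset hm0] at hw ⊢
      rw [mul_pow, hζ.pow_eq_one, one_mul, hw]
    · intro w hw
      rw [mem_nthRootsFinset hm0] at hw ⊢
      rw [mul_pow, inv_pow, hζ.pow_eq_one, inv_one, one_mul, hw]
    · intro w _
      exact inv_mul_cancel_left₀ (hζ.ne_zero hm0.ne') w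
    · intro w _
      exact mul_inv_cancel_left₀ (hζ.ne_zero hm0.ne') w
    · intro w _
      rfl
  rw [← Finset.mul_sum] at h
  have h' : (ζ - 1) * ∑ w ∈ nthRootsFinset m s, w = 0 := by linear_combination h
  exact (mul_eq_zero.1 h').resolve_left (sub_ne_zero.2 (hζ.ne_one hm))

/-- With `N = 2 * N' = δ * m` and `n = 2 * n' = δ * k`, the `n`-th powers of the `N`-th roots
of `A` are the multiples by `A ^ n'` of the `m`-th roots of a sign. -/
lemma exists_pow_eq_mul_iff {K : Type*} [Field K] [IsAlgClosed K] {A χ : K} (hA : A ≠ 0)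
    {N' n' δ m k : ℕ} (hN : 2 * N' = δ * m) (hn : 2 * n' = δ * k) (hN0 : 0 < N')
    (hkm : Nat.Coprime k m) (hχ : χ * χ = 1) (hAχ : A ^ N' = χ * A) (w : K) :
    (∃ y, y ^ (2 * N') = A ∧ y ^ (2 * n') = A ^ n' * w) ↔ w ^ m = χ ^ k := by
  have hχχ : χ ^ k * χ ^ k = 1 := by rw [← mul_pow, hχ, one_pow]
  have hnm : n' * m = N' * k := by
    have : 2 * (n' * m) = 2 * (N' * k) := by
      rw [← mul_assoc, ← mul_assoc, hn, hN]
      ring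
    lia
  have forward : ∀ y w : K, y ^ (2 * N') = A → y ^ (2 * n') = A ^ n' * w → w ^ m = χ ^ k := by
    intro y w hy hyw
    have h : (A ^ n' * w) ^ m = A ^ k := by
      rw [← hyw, ← hy, ← pow_mul, ← pow_mul, mul_assoc, hnm, mul_assoc]
    rw [mul_pow, ← pow_mul, hnm, pow_mul, hAχ, mul_pow] at h
    have hAk : A ^ k ≠ 0 := pow_ne_zero k hA
    have h' : A ^ k * (w ^ m - χ ^ k) = 0 := by
      linear_combination χ ^ k * h - A ^ k * w ^ m * hχχ
    exact sub_eq_zero.1 ((mul_eq_zero.1 h').resolve_left hAk)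
  refine ⟨fun ⟨y, hy, hyw⟩ => forward y w hy hyw, fun hw => ?_⟩
  have hδm : 0 < δ * m := by lia
  have hm : m ≠ 0 := (Nat.pos_of_mul_pos_left hδm).ne'
  obtain ⟨y, hy⟩ := IsAlgClosed.exists_pow_nat_eq A (n := 2 * N') (by lia)
  have hAn : A ^ n' ≠ 0 := pow_ne_zero n' hA
  obtain ⟨z, hz⟩ : ∃ z, y ^ (2 * n') = A ^ n' * z := ⟨y ^ (2 * n') / A ^ n', by field_simp⟩
  have hz0 : z ≠ 0 := by
    rintro rfl
    have hy0 : y ≠ 0 := by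
      rintro rfl
      exact hA (by rw [← hy, zero_pow (by lia)])
    exact pow_ne_zero _ hy0 (by rw [hz, mul_zero])
  have hzm := forward y z hy hz
  have hwz : (w / z) ^ m = 1 := by
    rw [div_pow, hw, hzm, div_self]
    exact left_ne_zero_of_mul_eq_one hχχ
  obtain ⟨t, ht⟩ := IsAlgClosed.exists_pow_nat_eq (w / z) (Nat.pos_of_mul_pos_right hδm)
  obtain ⟨c, hc⟩ := Nat.exists_mul_mod_eq_of_coprime 1 hkm hm
  refine ⟨y * t ^ c, ?_, ?_⟩
  · rw [mul_pow, hy, ← pow_mul, hN, show c * (δ * m) = δ * m * c by ring, pow_mul, pow_mul, ht,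
      hwz, one_pow, mul_one]
  · rw [mul_pow, hz, ← pow_mul, hn, show c * (δ * k) = δ * (k * c) by ring, pow_mul, ht,
      pow_eq_pow_of_modEq hc.2 hwz, pow_one]
    field_simp

lemma exists_algebraMap_eq_of_pow_card_eq {F L : Type*} [Field F] [Fintype F] [Field L]
    [Algebra F L] {x : L} (hx : x ^ Fintype.card F = x) : ∃ c : F, algebraMap F L c = x := by
  have hp : (X ^ Fintype.card F - X : L[X]) ≠ 0 :=
    FiniteField.X_pow_card_sub_X_ne_zero L Fintype.one_lt_card
  have hsub : Finset.univ.image (algebraMap F L) ⊆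
      (X ^ Fintype.card F - X : L[X]).roots.toFinset := by
    intro y hy
    obtain ⟨c, -, rfl⟩ := Finset.mem_image.1 hy
    rw [Multiset.mem_toFinset, mem_roots hp, IsRoot.def, eval_sub, eval_pow, eval_X, ← map_pow,
      FiniteField.pow_card, sub_self]
  have hcard : (X ^ Fintype.card F - X : L[X]).roots.toFinset.card ≤
      (Finset.univ.image (algebraMap F L)).card := by
    rw [Finset.card_image_of_injective _ (algebraMap F L).injective, Finset.card_univ]
    exact (Multiset.toFinset_card_le _).trans ((card_roots' _).trans
      (FiniteField.X_pow_card_sub_X_natDegree_eq L Fintype.one_lt_card).le)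
  have hmem : x ∈ (X ^ Fintype.card F - X : L[X]).roots.toFinset := by
    rw [Multiset.mem_toFinset, mem_roots hp, IsRoot.def, eval_sub, eval_pow, eval_X, hx, sub_self]
  rw [← Finset.eq_of_subset_of_card_le hsub hcard] at hmem
  obtain ⟨c, -, hc⟩ := Finset.mem_image.1 hmem
  exact ⟨c, hc⟩

/-- Roots of `T ^ 2 - x T + a` in an extension parametrize the elliptic set. -/
lemma exists_root_of_not_isSquare {F L : Type*} [Field F] [Fintype F] [Field L] [Algebra F L]
    [IsAlgClosed L] (h2 : (2 : F) ≠ 0) {a x : F} (hx : ¬ IsSquare (x ^ 2 - 4 * a)) :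
    ∃ y : L, y ^ Fintype.card F ≠ y ∧ y ^ (Fintype.card F + 1) = algebraMap F L a ∧
      algebraMap F L x = y + y ^ Fintype.card F := by
  have h2L : (2 : L) ≠ 0 := by
    rw [← map_ofNat (algebraMap F L) 2]
    exact (_root_.map_ne_zero _).2 h2
  obtain ⟨d, hd⟩ := IsAlgClosed.exists_pow_nat_eq (algebraMap F L (x ^ 2 - 4 * a)) two_pos
  rw [map_sub, map_mul, map_pow, map_ofNat] at hd
  obtain ⟨y, hy⟩ : ∃ y, 2 * y = algebraMap F L x + d :=
    ⟨(algebraMap F L x + d) / 2, by field_simp⟩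
  have hroot : y ^ 2 - algebraMap F L x * y + algebraMap F L a = 0 := by
    have : 2 * (2 * (y ^ 2 - algebraMap F L x * y + algebraMap F L a)) = 0 := by
      linear_combination (2 * y + d - algebraMap F L x) * hy + hd
    exact (mul_eq_zero.1 ((mul_eq_zero.1 this).resolve_left h2L)).resolve_left h2L
  have hne : y ^ Fintype.card F ≠ y := by
    intro h
    obtain ⟨c, rfl⟩ := exists_algebraMap_eq_of_pow_card_eq h
    refine hx ⟨2 * c - x, (algebraMap F L).injective ?_⟩
    simp only [map_sub, map_mul, map_pow, map_ofNat]
    linear_combination -4 * hroot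
  have hroot' := congrArg (FiniteField.frobeniusAlgHom F L) hroot
  simp only [map_sub, map_add, map_mul, map_pow, AlgHom.commutes, map_zero] at hroot'
  rw [FiniteField.coe_frobeniusAlgHom] at hroot'
  have hsum : algebraMap F L x = y + y ^ Fintype.card F := by
    have : (y ^ Fintype.card F - y) * (y + y ^ Fintype.card F - algebraMap F L x) = 0 := by
      linear_combination hroot' - hroot
    exact (sub_eq_zero.1 ((mul_eq_zero.1 this).resolve_left (sub_ne_zero.2 hne))).symm
  refine ⟨y, hne, ?_, hsum⟩
  rw [pow_succ]
  linear_combination -y * hsum - hroot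

lemma exists_not_isSquare_of_root {F L : Type*} [Field F] [Fintype F] [Field L] [Algebra F L]
    (h2 : (2 : F) ≠ 0) {a : F} {y : L} (hy0 : y ≠ 0) (hy : y ^ Fintype.card F ≠ y)
    (hya : y ^ (Fintype.card F + 1) = algebraMap F L a) :
    ∃ x : F, ¬ IsSquare (x ^ 2 - 4 * a) ∧ algebraMap F L x = y + y ^ Fintype.card F := by
  have h2L : (2 : L) ≠ 0 := by
    rw [← map_ofNat (algebraMap F L) 2]
    exact (_root_.map_ne_zero _).2 h2
  rw [pow_succ] at hya
  have hyy : (y ^ Fintype.card F) ^ Fintype.card F = y := by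
    have h := congrArg (FiniteField.frobeniusAlgHom F L) hya
    rw [map_mul, AlgHom.commutes, FiniteField.coe_frobeniusAlgHom, ← hya] at h
    have hq : y ^ Fintype.card F ≠ 0 := pow_ne_zero _ hy0
    exact mul_right_cancel₀ hq (by linear_combination h)
  obtain ⟨x, hx⟩ : ∃ x : F, algebraMap F L x = y + y ^ Fintype.card F := by
    refine exists_algebraMap_eq_of_pow_card_eq ?_
    have h := map_add (FiniteField.frobeniusAlgHom F L) y (y ^ Fintype.card F)
    rw [FiniteField.coe_frobeniusAlgHom] at h
    simp only at h
    rw [h, hyy, add_comm]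
  refine ⟨x, ?_, hx⟩
  rintro ⟨d, hd⟩
  have hd' := congrArg (algebraMap F L) hd
  simp only [map_sub, map_mul, map_pow, map_ofNat] at hd'
  have hprod : ((y - y ^ Fintype.card F) - algebraMap F L d) *
      ((y - y ^ Fintype.card F) + algebraMap F L d) = 0 := by
    rw [hx, ← hya] at hd'
    linear_combination hd'
  obtain ⟨e, he⟩ : ∃ e : F, y - y ^ Fintype.card F = algebraMap F L e := by
    rcases mul_eq_zero.1 hprod with h | h
    · exact ⟨d, sub_eq_zero.1 h⟩
    · exact ⟨-d, by rw [map_neg]; exact eq_neg_of_add_eq_zero_left h⟩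
  have hye : y = algebraMap F L ((x + e) / 2) := by
    rw [map_div₀, map_add, map_ofNat, hx, ← he]
    field_simp
    ring
  apply hy
  rw [hye, ← map_pow, FiniteField.pow_card]

/-- The sum of the distinct values of `w + w⁻¹` on the `m`-th roots of a sign `s`, where `1` is
left out under the condition `P`. -/
lemma sum_image_add_inv_nthRootsFinset {K : Type*} [Field K] [IsAlgClosed K] (h2 : (2 : K) ≠ 0)
    {m : ℕ} (hm : (m : K) ≠ 0) {s : K} (hs : s * s = 1) (P : Prop)
    [Decidable P] :
    ∑ v ∈ ((nthRootsFinset m s).filter (fun w => ¬ (P ∧ w = 1))).image (fun w => w + w⁻¹), v =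
      (if m = 1 then s else 0) + (if s = 1 then 1 else 0) - (if (-1) ^ m = s then 1 else 0)
        - (if P ∧ s = 1 then 2 else 0) := by
  have hm0 : 0 < m := Nat.pos_of_ne_zero (by rintro rfl; exact hm Nat.cast_zero)
  have hs0 : s ≠ 0 := left_ne_zero_of_mul_eq_one hs
  have hne : (-1 : K) ≠ 1 := fun h => h2 (by linear_combination -h)
  have hall : ∑ w ∈ nthRootsFinset m s, w = if m = 1 then s else 0 := by
    split_ifs with h
    · have : nthRootsFinset m s = {s} := by
        ext w
        rw [mem_nthRootsFinset hm0, h, pow_one, Finset.mem_singleton]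
      rw [this, Finset.sum_singleton]
    · exact sum_nthRootsFinset_eq_zero (by lia) hm s
  have hfilter := Finset.sum_filter_add_sum_filter_not (nthRootsFinset m s)
    (fun w => ¬ (P ∧ w = 1)) (fun w => w)
  have hrest : ∑ w ∈ nthRootsFinset m s with ¬¬(P ∧ w = 1), w = if P ∧ s = 1 then 1 else 0 := by
    simp only [not_not]
    split_ifs with h
    · have : (nthRootsFinset m s).filter (fun w => P ∧ w = 1) = {1} := by
        ext w
        rw [Finset.mem_filter, mem_nthRootsFinset hm0, Finset.mem_singleton, h.2]
        exact ⟨fun hw => hw.2.2, fun hw => ⟨by rw [hw, one_pow], h.1, hw⟩⟩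
      rw [this, Finset.sum_singleton]
    · refine Finset.sum_eq_zero fun w hw => ?_
      rw [Finset.mem_filter, mem_nthRootsFinset hm0] at hw
      obtain ⟨hw, hP, rfl⟩ := hw
      exact absurd ⟨hP, by rw [← hw, one_pow]⟩ h
  rw [sum_image_add_inv h2]
  · rw [hall, hrest] at hfilter
    rw [← hfilter]
    simp only [Finset.mem_filter, mem_nthRootsFinset hm0, one_pow, hne, and_false, not_false_eq_true,
      and_true, eq_comm (a := (1 : K)) (b := s)]
    by_cases hP : P <;> by_cases h1 : s = 1 <;> simp [hP, h1]
    ring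
  · intro w hw
    rw [Finset.mem_filter, mem_nthRootsFinset hm0] at hw
    rintro rfl
    exact hs0 (by rw [← hw.1, zero_pow hm0.ne'])
  · intro w hw
    rw [Finset.mem_filter, mem_nthRootsFinset hm0] at hw ⊢
    rw [inv_eq_one]
    · exact ⟨by rw [inv_pow, hw.1, inv_eq_of_mul_eq_one_left hs], hw.2⟩

/-- The `n`-th powers of the elements `y ∉ F` of norm `a`, up to the factor `a ^ (n / 2)`. The
value `1` is lost exactly when it is attained at the square roots of `a` only. -/
lemma exists_pow_card_ne_and_pow_eq_iff {F L : Type*} [Field F] [Fintype F] [Field L] [Algebra F L]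
    [IsAlgClosed L] {a : F} (ha : a ≠ 0) {N' n' δ m k : ℕ} (hcard : Fintype.card F + 1 = 2 * N')
    (hN : 2 * N' = δ * m) (hn : 2 * n' = δ * k) (hkm : Nat.Coprime k m) (hδ : 2 ∣ δ)
    (hχ : a ^ (N' - 1) * a ^ (N' - 1) = 1) (w : L) :
    (∃ y, y ^ Fintype.card F ≠ y ∧ y ^ (Fintype.card F + 1) = algebraMap F L a ∧
      y ^ (2 * n') = algebraMap F L a ^ n' * w) ↔
    w ^ m = algebraMap F L (a ^ (N' - 1)) ^ k ∧ ¬ (IsSquare a ∧ δ = 2 ∧ w = 1) := by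
  have hA : algebraMap F L a ≠ 0 := (_root_.map_ne_zero _).2 ha
  have hN0 : 0 < N' := by lia
  have hδ0 : 0 < δ := Nat.pos_of_mul_pos_right (show 0 < δ * m by lia)
  have key := exists_pow_eq_mul_iff hA hN hn hN0 hkm
    (χ := algebraMap F L a ^ (N' - 1)) (by rw [← map_pow, ← map_mul, hχ, map_one])
    (by rw [← pow_succ, Nat.sub_add_cancel hN0]) w
  rw [map_pow, ← key, hcard]
  have hroot : ∀ c : F, c * c = a →
      algebraMap F L c ^ (2 * N') = algebraMap F L a ∧
        algebraMap F L c ^ (2 * n') = algebraMap F L a ^ n' := by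
    intro c hc
    rw [← hcard, pow_succ, pow_mul, ← map_pow, FiniteField.pow_card, ← map_mul, ← map_pow, sq, hc]
    exact ⟨rfl, rfl⟩
  constructor
  · rintro ⟨y, hy, hyA, hyw⟩
    refine ⟨⟨y, hyA, hyw⟩, ?_⟩
    rintro ⟨⟨c, hc⟩, rfl, rfl⟩
    obtain ⟨hcN, hcn⟩ := hroot c hc.symm
    have hcop : Nat.gcd (2 * N') (2 * n') = 2 := by
      rw [hN, hn, Nat.gcd_mul_left, hkm.symm.gcd_eq_one]
    have h1 : (y / algebraMap F L c) ^ (2 * N') = 1 := by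
      rw [div_pow, hyA, hcN, div_self hA]
    have h2 : (y / algebraMap F L c) ^ (2 * n') = 1 := by
      rw [div_pow, hyw, hcn, mul_one, div_self (pow_ne_zero _ hA)]
    have h3 := pow_gcd_eq_one.2 ⟨h1, h2⟩
    have hc0 : algebraMap F L c ≠ 0 := by
      rintro h0
      rw [h0, zero_pow (by lia)] at hcN
      exact hA hcN.symm
    apply hy
    obtain ⟨d, rfl⟩ : ∃ d : F, algebraMap F L d = y := by
      rw [hcop, sq] at h3
      rcases mul_self_eq_one_iff.1 h3 with h | h
      · exact ⟨c, (eq_of_div_eq_one h).symm⟩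
      · exact ⟨-c, by rw [map_neg, (div_eq_iff hc0).1 h, neg_one_mul]⟩
    rw [← map_pow, FiniteField.pow_card]
  · rintro ⟨⟨y, hyA, hyw⟩, hw⟩
    by_cases hy : y ^ Fintype.card F = y
    · obtain ⟨c, rfl⟩ := exists_algebraMap_eq_of_pow_card_eq hy
      have hc : c * c = a := by
        apply (algebraMap F L).injective
        rw [← hyA, ← hcard, pow_succ, hy, map_mul]
      obtain ⟨hcN, hcn⟩ := hroot c hc
      obtain rfl : w = 1 := by
        rw [hcn] at hyw
        exact (mul_eq_left₀ (pow_ne_zero _ hA)).1 hyw.symm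
      have hδ2 : δ ≠ 2 := fun h => hw ⟨⟨c, hc.symm⟩, h, rfl⟩
      have : NeZero (δ : L) := by
        refine ⟨fun h => ?_⟩
        have h' : ((Fintype.card F + 1 : ℕ) : F) = 1 := by simp
        have h'' := congrArg (algebraMap F L) h'
        rw [map_natCast, hcard, hN, Nat.cast_mul, h, zero_mul, map_one] at h''
        exact zero_ne_one h''
      obtain ⟨ζ, hζ⟩ := HasEnoughRootsOfUnity.exists_primitiveRoot L δ
      refine ⟨algebraMap F L c * ζ, fun h => ?_, ?_, ?_⟩
      · have hc0 : algebraMap F L c ≠ 0 := by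
          rintro h0
          rw [h0, zero_pow (by lia)] at hcN
          exact hA hcN.symm
        rw [mul_pow, hy] at h
        have h1 : ζ ^ Fintype.card F = ζ := mul_left_cancel₀ hc0 h
        have h2 : ζ ^ 2 = 1 := by
          rw [sq]
          nth_rewrite 1 [← h1]
          rw [← pow_succ, hcard, hN, pow_mul, hζ.pow_eq_one, one_pow]
        exact hδ2 (Nat.dvd_antisymm (hζ.dvd_of_pow_eq_one 2 h2) hδ)
      · rw [mul_pow, hcN, hN, pow_mul ζ, hζ.pow_eq_one, one_pow, mul_one]
      · rw [mul_pow, hcn, hn, pow_mul ζ, hζ.pow_eq_one, one_pow]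
    · exact ⟨y, hy, hyA, hyw⟩

/-- The sum of the distinct values of `D_n(·,a)` on the elliptic set. -/
theorem elliptic_image_sum {F : Type*} [Field F] [Fintype F]
    {q : ℕ} (hF : Fintype.card F = q) (hq : Odd q) (hq3 : 3 < q)
    (a : F) (ha : a ≠ 0) (n : ℕ) (hn : Even n)
    (δ : ℕ) (hδ : δ = Nat.gcd n (q + 1)) :
    ∑ y ∈ Finset.image (fun x : F => Polynomial.eval x (Polynomial.dickson 1 a n))
        (Finset.filter (fun x : F => ¬ IsSquare (x ^ 2 - 4 * a)) Finset.univ), y =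
      if δ = q + 1 then 2 * (a ^ ((q - 1) / 2)) ^ (n / δ) * a ^ (n / 2)
      else if ¬ IsSquare a then
        (if Even ((q + 1) / δ) then 0 else (-1 : F) ^ (n / δ) * a ^ (n / 2))
      else
        if Odd ((q + 1) / δ) ∧ δ = 2 then -(a ^ (n / 2))
        else if Odd ((q + 1) / δ) ∧ δ ≠ 2 then a ^ (n / 2)
        else if Even ((q + 1) / δ) ∧ δ = 2 then -(2 * a ^ (n / 2))
        else 0 := by
  have hcq : (q : F) = 0 := by rw [← hF]; simp
  have hchar : ringChar F ≠ 2 := by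
    intro h
    have := FiniteField.even_card_of_char_two h
    rw [hF] at this
    exact absurd hq (by rw [Nat.not_odd_iff]; exact this)
  have h2 : (2 : F) ≠ 0 := Ring.two_ne_zero hchar
  obtain ⟨N', hN'⟩ : ∃ N', q + 1 = 2 * N' := hq.add_one.two_dvd
  obtain ⟨n', rfl⟩ := hn.two_dvd
  have hδn : δ ∣ 2 * n' := hδ ▸ Nat.gcd_dvd_left _ _
  have hδq : δ ∣ q + 1 := hδ ▸ Nat.gcd_dvd_right _ _
  have hδ2 : 2 ∣ δ := hδ ▸ Nat.dvd_gcd (dvd_mul_right _ _) (hN' ▸ dvd_mul_right _ _)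
  have hδ0 : 0 < δ := Nat.pos_of_dvd_of_pos hδq q.succ_pos
  have hkm : Nat.Coprime (2 * n' / δ) ((q + 1) / δ) := by
    rw [hδ] at hδ0 ⊢
    exact Nat.coprime_div_gcd_div_gcd hδ0
  obtain ⟨k, hk⟩ := hδn
  obtain ⟨m, hm⟩ := hδq
  have hk' : 2 * n' / δ = k := by rw [hk, Nat.mul_div_cancel_left _ hδ0]
  have hm' : (q + 1) / δ = m := by rw [hm, Nat.mul_div_cancel_left _ hδ0]
  have hn' : 2 * n' / 2 = n' := by lia
  have hq2 : (q - 1) / 2 = N' - 1 := by lia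
  have hq2' : q / 2 = N' - 1 := by lia
  rw [hk', hm'] at hkm
  rw [hk', hm', hn', hq2]
  have hm1 : δ = q + 1 ↔ m = 1 := by
    rw [hm]
    exact ⟨fun h => Nat.eq_of_mul_eq_mul_left hδ0 (by lia), fun h => by rw [h, mul_one]⟩
  have hmF : (m : F) ≠ 0 := by
    intro h
    have h' : ((q + 1 : ℕ) : F) = 1 := by simp [hcq]
    rw [hm, Nat.cast_mul, h, mul_zero] at h'
    exact zero_ne_one h'
  set χ : F := a ^ (N' - 1) with hχdef
  have hχsq : IsSquare a ↔ χ = 1 := by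
    rw [FiniteField.isSquare_iff hchar ha, hF, hq2']
  have hχ : χ = 1 ∨ χ = -1 := by
    rw [hχdef, ← hq2', ← hF]
    exact FiniteField.pow_dichotomy hchar ha
  have hχχ : χ * χ = 1 := by rcases hχ with h | h <;> simp [h]
  obtain ⟨L, _, _, _⟩ : ∃ (L : Type _) (_ : Field L) (_ : Algebra F L), IsAlgClosed L :=
    ⟨AlgebraicClosure F, inferInstance, inferInstance, inferInstance⟩
  let φ := algebraMap F L
  have hφtwo : φ 2 = 2 := map_ofNat φ 2
  have hφ2 : (2 : L) ≠ 0 := by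
    rw [← hφtwo]
    exact (_root_.map_ne_zero φ).2 h2
  have hφm : (m : L) ≠ 0 := by
    rw [← map_natCast φ m]
    exact (_root_.map_ne_zero φ).2 hmF
  have hφa : φ a ≠ 0 := (_root_.map_ne_zero φ).2 ha
  have hb : φ a ^ n' ≠ 0 := pow_ne_zero _ hφa
  have hs : φ χ ^ k * φ χ ^ k = 1 := by rw [← mul_pow, ← map_mul, hχχ, map_one, one_pow]
  have hpar := fun w : L => exists_pow_card_ne_and_pow_eq_iff ha (by rw [hF, hN'])
    (by rw [← hN', hm]) hk hkm hδ2 hχχ w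
  rw [← hχdef, hF] at hpar
  have heval : ∀ (x : F) (y w : L), y ^ (q + 1) = φ a → φ x = y + y ^ q →
      y ^ (2 * n') = φ a ^ n' * w →
      φ ((dickson 1 a (2 * n')).eval x) = φ a ^ n' * (w + w⁻¹) := by
    intro x y w hy hx hw
    have h1 : y * y ^ q = φ a := by rw [← hy, pow_succ']
    have hw0 : w ≠ 0 := by
      rintro rfl
      have hy0 : y ≠ 0 := by
        rintro rfl
        exact hφa (by rw [← hy, zero_pow (by lia)])
      exact pow_ne_zero _ hy0 (by rw [hw, mul_zero])
    have h3 : φ a ^ n' * w * (y ^ q) ^ (2 * n') = φ a ^ n' * φ a ^ n' := by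
      rw [← hw, ← mul_pow, h1, ← pow_add, two_mul]
    rw [← eval₂_at_apply, ← eval_map, map_dickson, hx, ← h1, eval_dickson_one_mul_add, h1, hw]
    have h4 : (y ^ q) ^ (2 * n') = φ a ^ n' * w⁻¹ := by
      field_simp
      exact mul_left_cancel₀ hb (by linear_combination h3)
    rw [h4, mul_add]
  have himage : ((Finset.univ.filter (fun x : F => ¬ IsSquare (x ^ 2 - 4 * a))).image
      (fun x => eval x (dickson 1 a (2 * n')))).image φ =
      (((nthRootsFinset m (φ χ ^ k)).filter
        (fun w => ¬ ((IsSquare a ∧ δ = 2) ∧ w = 1))).image (fun w => w + w⁻¹)).image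
        (fun v => φ a ^ n' * v) := by
    have hm0 : 0 < m := Nat.pos_of_ne_zero (by rintro rfl; exact hmF Nat.cast_zero)
    ext v
    simp only [Finset.image_image, Finset.mem_image, Finset.mem_filter, Finset.mem_univ, true_and,
      mem_nthRootsFinset hm0, Function.comp_apply, and_assoc]
    constructor
    · rintro ⟨x, hx, rfl⟩
      obtain ⟨y, hy, hya, hxy⟩ := exists_root_of_not_isSquare (L := L) h2 hx
      rw [hF] at hy hya hxy
      obtain ⟨w, hw⟩ : ∃ w, y ^ (2 * n') = φ a ^ n' * w :=
        ⟨y ^ (2 * n') / φ a ^ n', by field_simp⟩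
      obtain ⟨hw1, hw2⟩ := (hpar w).1 ⟨y, hy, hya, hw⟩
      exact ⟨w, hw1, hw2, (heval x y w hya hxy hw).symm⟩
    · rintro ⟨w, hw1, hw2, rfl⟩
      obtain ⟨y, hy, hya, hw⟩ := (hpar w).2 ⟨hw1, hw2⟩
      have hy0 : y ≠ 0 := by
        rintro rfl
        exact hφa (by rw [← hya, zero_pow (by lia)])
      obtain ⟨x, hx, hxy⟩ := exists_not_isSquare_of_root h2 hy0 (by rwa [hF]) (by rwa [hF])
      rw [hF] at hxy
      exact ⟨x, hx, heval x y w hya hxy hw⟩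
  apply φ.injective
  rw [map_sum, ← Finset.sum_image (f := fun v => v) (g := φ) φ.injective.injOn, himage,
    Finset.sum_image (mul_right_injective₀ hb).injOn, ← Finset.mul_sum,
    sum_image_add_inv_nthRootsFinset hφ2 hφm hs]
  have hne : (-1 : L) ≠ 1 := fun h => hφ2 (by linear_combination -h)
  simp only [hm1, hχsq]
  have hδm2 : m = 1 → δ ≠ 2 := by
    rintro rfl
    lia
  rcases hχ with h | h
  · rw [h]
    by_cases h1 : m = 1
    · simp [h1, hδm2 h1, hne, hφtwo]
      ring
    rcases Nat.even_or_odd m with hm2 | hm2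
    · have hm3 := Nat.not_odd_iff_even.2 hm2
      by_cases h3 : δ = 2 <;> simp [h1, hm2, hm3, h3, hm2.neg_one_pow, hφtwo]
      ring
    · by_cases h3 : δ = 2 <;> simp [h1, hm2, h3, hm2.neg_one_pow, hne]
      ring
  · have hneF : (-1 : F) ≠ 1 := fun h => h2 (by linear_combination -h)
    rw [h, map_neg, map_one]
    rcases Nat.even_or_odd m with hm2 | hm2
    · have hk2 : Odd k := by
        rw [← Nat.not_even_iff_odd]
        intro hk2
        have := Nat.dvd_gcd hk2.two_dvd hm2.two_dvd
        rw [hkm.gcd_eq_one] at this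
        lia
      have h1 : m ≠ 1 := by
        rintro rfl
        exact absurd hm2 (by decide)
      simp [h1, hm2, hm2.neg_one_pow, hk2.neg_one_pow, hne, hne.symm, hneF]
    · have hm3 := Nat.not_even_iff_odd.2 hm2
      rcases Nat.even_or_odd k with hk2 | hk2 <;> by_cases h1 : m = 1 <;>
        simp [h1, hm3, hm2.neg_one_pow, hk2.neg_one_pow, hne, hneF, hφtwo] <;> ring
end
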